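/- arXiv:1002.0969 — 3 statements merged into one kernel-verified Lean document; each statement's English description precedes it below -/
import Mathlib

section
/- Let χ be a linear functional on W of height -1, 0 or 1 and let λ, λ' ∈ Λ(χ) with λ ∉ {0, p-1} and λ' ∉ {0, p-1}. Then Ext(V_χ(λ'), V_χ(λ)), taken in the category of W-modules with p-character χ, is isomorphic to K if one of the following holds: (i) [λ-λ'] ∈ {2, 3}; (ii) [λ-λ'] = 4 and p ≠ 5; (iii) [λ-λ'] = 6, p > 7, and 2λ = 5 + s or 2λ = 5 - s for some s ∈ K with s^2 = 19; and Ext(V_χ(λ'), V_χ(λ)) = 0 otherwise. -/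
/-!
Common setup: the Witt algebra `W` over `K` (char `p > 3`) has basis
`e_{-1}, e_0, ..., e_{p-2}` with `[e_i, e_j] = (j-i) e_{i+j}` (and `e_k = 0`
outside the range), and `p`-mapping `e_i^{[p]} = δ_{i0} e_i`.  A module with
`p`-character `χ` over `W` (resp. the subalgebra `W_0 = <e_0, ..., e_{p-2}>`)
is given by a family of endomorphisms `ρ k` (`k : ℤ`, vanishing outside
`[lo, p-2]` where `lo = -1` for `W` and `lo = 0` for `W_0`) satisfying the
bracket relations and `(ρ i)^p - δ_{i0} ρ i = χ(e_i)^p • 1`.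

The Baer Ext space `Ext(N, M)` of two such modules, in the category of
modules with `p`-character `χ`, is realized concretely: an extension
`0 → M → E → N → 0` admits a linear splitting `E ≃ M ⊕ N`, under which the
action of `e_k` is `(m, n) ↦ (ρM k m + c k n, ρN k n)` for a "cocycle"
`c : ℤ → (N →ₗ M)`; the conditions for `E` to be a module with `p`-character
`χ` are the cocycle conditions below, Baer equivalence corresponds to
differing by a coboundary, and the Baer sum / scalar action correspond to the
linear structure on cocycles.  So `Ext(N, M) ≅ cocycles / coboundaries`.
-/

set_option maxHeartbeats 1000000
set_option synthInstance.maxHeartbeats 1000000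

noncomputable section

/-- The coefficient `(-1)^j · (i!/(i-j)!) · ((j+1)λ - i + j)` of the action
`e_j · v_i = (coefficient) · v_{i-j}` on the reduced Verma module; it vanishes
for `j > i` since then `Nat.descFactorial i j = 0`. -/
def wCoef (K : Type) [Field K] (lam : K) (j i : ℕ) : K :=
  (-1 : K) ^ j * (Nat.descFactorial i j : K) * (((j : K) + 1) * lam - (i : K) + (j : K))

/-- Matrices (in the basis `v_0, ..., v_{p-1}`) of the generators `e_j`
(`j : ℤ`) acting on the reduced Verma module `V_χ(λ)`; here `c = χ(e_{-1})^p`.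
`e_{-1} v_i = v_{i+1}` for `i < p-1`, `e_{-1} v_{p-1} = c v_0`, and for
`0 ≤ j ≤ p-2`, `e_j v_i = (-1)^j (i!/(i-j)!) ((j+1)λ - i + j) v_{i-j}`. -/
def vermaMat (K : Type) [Field K] (p : ℕ) (c lam : K) : ℤ → Matrix (Fin p) (Fin p) K :=
  fun j =>
    if j = -1 then
      Matrix.of fun k l =>
        if (k : ℕ) = (l : ℕ) + 1 then 1
        else if (k : ℕ) = 0 ∧ (l : ℕ) = p - 1 then c else 0
    else if 0 ≤ j ∧ j ≤ (p : ℤ) - 2 then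
      Matrix.of fun k l =>
        if (l : ℕ) = (k : ℕ) + j.toNat then wCoef K lam j.toNat (l : ℕ) else 0
    else 0

/-- The action of the basis elements `e_j` (`j : ℤ`) on the reduced Verma
module `V_χ(λ)`, with `c = χ(e_{-1})^p`. -/
def vermaRho (K : Type) [Field K] (p : ℕ) (c lam : K) : ℤ → Module.End K (Fin p → K) :=
  fun j => Matrix.toLin' (vermaMat K p c lam j)

/-- The one-dimensional `W_0`-module `K_λ`: `e_0` acts by `λ`, all other `e_j` act by `0`. -/
def oneDimRho (K : Type) [Field K] (lam : K) : ℤ → Module.End K K :=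
  fun j => if j = 0 then lam • (1 : Module.End K K) else 0

/-- The one-dimensional trivial module: every basis element acts by `0`. -/
def trivRho (K : Type) [Field K] : ℤ → Module.End K K := fun _ => 0

/-- The coefficient `(-1)^(j+1) · ((i+1)!/(i-j)!)` of the action
`e_j · u_i = (coefficient) · u_{i-j}` on the `(p-1)`-dimensional simple module `S`. -/
def sCoef (K : Type) [Field K] (j i : ℕ) : K :=
  (-1 : K) ^ (j + 1) * (Nat.descFactorial (i + 1) (j + 1) : K)

/-- Matrices (in the basis `u_0, ..., u_{p-2}`) of the generators `e_j` acting on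
the `(p-1)`-dimensional simple restricted module `S = V_0(p-1)/Soc(V_0(p-1))`. -/
def sMat (K : Type) [Field K] (p : ℕ) : ℤ → Matrix (Fin (p - 1)) (Fin (p - 1)) K :=
  fun j =>
    if j = -1 then
      Matrix.of fun k l => if (k : ℕ) = (l : ℕ) + 1 then 1 else 0
    else if 0 ≤ j ∧ j ≤ (p : ℤ) - 2 then
      Matrix.of fun k l =>
        if (l : ℕ) = (k : ℕ) + j.toNat then sCoef K j.toNat (l : ℕ) else 0
    else 0

/-- The action of the basis elements `e_j` on the simple module `S`. -/
def sRho (K : Type) [Field K] (p : ℕ) : ℤ → Module.End K (Fin (p - 1) → K) :=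
  fun j => Matrix.toLin' (sMat K p j)

section ExtSpace

variable (K : Type) [Field K] (M N : Type) [AddCommGroup M] [Module K M]
  [AddCommGroup N] [Module K N]

/-- Constraint: a cocycle vanishes outside the index range `[lo, p-2]`. -/
def suppConstraint (p : ℕ) (lo k : ℤ) : (ℤ → N →ₗ[K] M) →ₗ[K] (N →ₗ[K] M) :=
  if k < lo ∨ (p : ℤ) - 2 < k then LinearMap.proj k else 0

variable {M N}

/-- Constraint on a cocycle coming from the bracket relation
`[e_i, e_j] = (j - i) e_{i+j}`:
`(j-i) c(i+j) = ρM i ∘ c j + c i ∘ ρN j - ρM j ∘ c i - c j ∘ ρN i`. -/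
def bracketConstraint (p : ℕ) (lo : ℤ) (ρM : ℤ → Module.End K M)
    (ρN : ℤ → Module.End K N) (i j : ℤ) :
    (ℤ → N →ₗ[K] M) →ₗ[K] (N →ₗ[K] M) :=
  if lo ≤ i ∧ i ≤ (p : ℤ) - 2 ∧ lo ≤ j ∧ j ≤ (p : ℤ) - 2 then
    ((j - i : ℤ) : K) • LinearMap.proj (i + j)
      - LinearMap.llcomp K N M M (ρM i) ∘ₗ LinearMap.proj j
      - LinearMap.lcomp K M (ρN j) ∘ₗ LinearMap.proj i
      + LinearMap.llcomp K N M M (ρM j) ∘ₗ LinearMap.proj i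
      + LinearMap.lcomp K M (ρN i) ∘ₗ LinearMap.proj j
  else 0

/-- Constraint on a cocycle expressing that the extension has `p`-character `χ`:
on the extension `E = M ⊕ N` the `(N → M)`-component of `(e_i)^p` is
`∑_{k<p} (ρM i)^k ∘ c i ∘ (ρN i)^(p-1-k)`, and this must agree with the
`(N → M)`-component of `e_i^{[p]} + χ(e_i)^p • 1`, which is `δ_{i0} c i`
(the scalar `χ(e_i)^p` contributes nothing off the diagonal, and the diagonal
blocks hold since `M`, `N` have `p`-character `χ`). -/
def pcharConstraint (p : ℕ) (lo : ℤ) (ρM : ℤ → Module.End K M)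
    (ρN : ℤ → Module.End K N) (i : ℤ) :
    (ℤ → N →ₗ[K] M) →ₗ[K] (N →ₗ[K] M) :=
  if lo ≤ i ∧ i ≤ (p : ℤ) - 2 then
    (∑ k ∈ Finset.range p,
        LinearMap.llcomp K N M M ((ρM i) ^ k) ∘ₗ
          LinearMap.lcomp K M ((ρN i) ^ (p - 1 - k)) ∘ₗ LinearMap.proj i)
      - (if i = 0 then (LinearMap.proj 0 : (ℤ → N →ₗ[K] M) →ₗ[K] (N →ₗ[K] M)) else 0)
  else 0

/-- The space of cocycles: families `c : ℤ → (N →ₗ M)` (the values of a linear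
map `W → Hom(N, M)` on the basis, `lo = -1` for `W` and `lo = 0` for `W_0`)
such that `M ⊕ N` with action `e_k (m, n) = (ρM k m + c k n, ρN k n)` is a
module with `p`-character `χ`. -/
def cocycles (p : ℕ) (lo : ℤ) (ρM : ℤ → Module.End K M) (ρN : ℤ → Module.End K N) :
    Submodule K (ℤ → N →ₗ[K] M) :=
  (⨅ k : ℤ, LinearMap.ker (suppConstraint K M N p lo k)) ⊓
    (⨅ i : ℤ, ⨅ j : ℤ, LinearMap.ker (bracketConstraint K p lo ρM ρN i j)) ⊓
    (⨅ i : ℤ, LinearMap.ker (pcharConstraint K p lo ρM ρN i))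

/-- The coboundaries: cocycles of the form `k ↦ ρM k ∘ f - f ∘ ρN k` for a
linear map `f : N → M`; these are exactly the cocycles of split extensions,
and two cocycles give Baer-equivalent extensions iff they differ by a
coboundary. -/
def coboundaries (p : ℕ) (lo : ℤ) (ρM : ℤ → Module.End K M) (ρN : ℤ → Module.End K N) :
    Submodule K (ℤ → N →ₗ[K] M) :=
  LinearMap.range (LinearMap.pi fun k : ℤ =>
    if lo ≤ k ∧ k ≤ (p : ℤ) - 2 then
      LinearMap.llcomp K N M M (ρM k) - LinearMap.lcomp K M (ρN k)
    else 0)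

/-- The Baer Ext space `Ext(N, M)` in the category of modules with
`p`-character `χ` (over `W` if `lo = -1`, over `W_0` if `lo = 0`), realized
as cocycles modulo coboundaries. -/
abbrev extSpace (p : ℕ) (lo : ℤ) (ρM : ℤ → Module.End K M) (ρN : ℤ → Module.End K N) :=
  (cocycles K p lo ρM ρN) ⧸
    (Submodule.comap (cocycles K p lo ρM ρN).subtype (coboundaries K p lo ρM ρN))

end ExtSpace

end

namespace WittExt

section Coefficients

variable {K : Type} [Field K]

/-- The polynomial in `x` whose value at `x = i` is the coefficient of `e_j` on `v_i`. -/
def wc (lam : K) (j : ℕ) (x : K) : K :=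
  (-1) ^ j * (∏ s ∈ Finset.range j, (x - (s : K))) * (((j : K) + 1) * lam - x + j)

lemma cast_descFactorial_eq_prod (n j : ℕ) :
    ((n.descFactorial j : ℕ) : K) = ∏ s ∈ Finset.range j, ((n : K) - (s : K)) := by
  induction j with
  | zero => simp
  | succ k ih =>
    rw [Finset.prod_range_succ, ← ih, Nat.descFactorial_succ, Nat.cast_mul]
    rcases le_or_gt k n with h | h
    · rw [Nat.cast_sub h]; ring
    · rw [Nat.descFactorial_eq_zero_iff_lt.2 h]; simp

lemma wCoef_eq_wc (lam : K) (j n : ℕ) : wCoef K lam j n = wc lam j (n : K) := by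
  rw [wCoef, wc, cast_descFactorial_eq_prod]

lemma wc_eq_zero_of_lt (lam : K) {j n : ℕ} (h : n < j) : wc lam j (n : K) = 0 := by
  rw [wc, ← cast_descFactorial_eq_prod, Nat.descFactorial_eq_zero_iff_lt.2 h]; simp

lemma wc_zero (lam x : K) : wc lam 0 x = lam - x := by simp [wc]

lemma wc_succ_add_one (lam x : K) (j : ℕ) :
    wc lam (j + 1) (x + 1) = wc lam (j + 1) x - ((j : K) + 2) * wc lam j x := by
  have h : ∏ s ∈ Finset.range j, (x + 1 - ((s + 1 : ℕ) : K)) =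
      ∏ s ∈ Finset.range j, (x - (s : K)) :=
    Finset.prod_congr rfl fun s _ => by push_cast; ring
  simp only [wc]
  rw [Finset.prod_range_succ', h, Finset.prod_range_succ]
  push_cast
  ring

end Coefficients

section Basis

variable {K : Type} [Field K] {p : ℕ}

/-- The vectors `e_{-1}^n v_0` of the reduced Verma module. -/
def vv (p : ℕ) (c : K) (n : ℕ) : Fin p → K :=
  fun k => if (k : ℕ) = n % p then c ^ (n / p) else 0

lemma vv_eq_single (c : K) {n : ℕ} (hn : n < p) : vv p c n = Pi.single ⟨n, hn⟩ 1 := by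
  funext k
  simp [vv, Nat.mod_eq_of_lt hn, Nat.div_eq_of_lt hn, Pi.single_apply, Fin.ext_iff]

lemma vv_eq_smul_single (hp : 0 < p) (c : K) (n : ℕ) :
    vv p c n = c ^ (n / p) • Pi.single ⟨n % p, Nat.mod_lt n hp⟩ 1 := by
  funext k
  simp [vv, Pi.single_apply, Fin.ext_iff]

lemma vv_add_self (hp : 0 < p) (c : K) (n : ℕ) : vv p c (n + p) = c • vv p c n := by
  funext k
  simp only [vv, Nat.add_mod_right, Nat.add_div_right n hp, Pi.smul_apply, smul_eq_mul, pow_succ]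
  split_ifs <;> ring

lemma vermaRho_neg_one_vv (hp : 1 < p) (c lam : K) (n : ℕ) :
    vermaRho K p c lam (-1) (vv p c n) = vv p c (n + 1) := by
  have hp0 : 0 < p := by omega
  rw [vv_eq_smul_single hp0, map_smul]
  funext k
  have hr := Nat.mod_lt n hp0
  have hn := Nat.div_add_mod n p
  set q := n / p
  set r := n % p
  have hcol : vermaRho K p c lam (-1) (Pi.single ⟨r, hr⟩ 1) k =
      if (k : ℕ) = r + 1 then 1 else if (k : ℕ) = 0 ∧ r = p - 1 then c else 0 := by
    simp [vermaRho, vermaMat]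
  rw [Pi.smul_apply, hcol, vv, ← hn]
  have hk := k.2
  by_cases h : r = p - 1
  · have : p * q + r + 1 = 0 + p * (q + 1) := by rw [h, mul_add]; omega
    rw [this, Nat.add_mul_mod_self_left, Nat.add_mul_div_left _ _ hp0]
    have h2 : (k : ℕ) ≠ r + 1 := by omega
    rw [if_neg h2]
    simp only [h, and_true, Nat.zero_mod, Nat.zero_div, zero_add]
    split_ifs <;> simp [pow_succ]
  · have : p * q + r + 1 = (r + 1) + p * q := by ring
    rw [this, Nat.add_mul_mod_self_left, Nat.add_mul_div_left _ _ hp0,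
      Nat.mod_eq_of_lt (by omega), Nat.div_eq_of_lt (by omega)]
    simp [h]

lemma vermaRho_neg_one_pow_vv (hp : 1 < p) (c lam : K) (m n : ℕ) :
    (vermaRho K p c lam (-1) ^ m) (vv p c n) = vv p c (n + m) := by
  induction m with
  | zero => simp
  | succ m ih => rw [pow_succ', Module.End.mul_apply, ih, vermaRho_neg_one_vv hp]; rfl

lemma wc_natCast_mod [CharP K p] (lam : K) (j n : ℕ) :
    wc lam j ((n % p : ℕ) : K) = wc lam j (n : K) := by
  have : ((n % p : ℕ) : K) = (n : K) := by
    conv_rhs => rw [← Nat.div_add_mod n p]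
    simp
  rw [this]

lemma vermaRho_natCast_vv [CharP K p] (hp : 1 < p) (c lam : K) {j : ℕ} (hj : j + 2 ≤ p) (n : ℕ) :
    vermaRho K p c lam (j : ℤ) (vv p c n) = wc lam j (n : K) • vv p c (n - j) := by
  have hp0 : 0 < p := by omega
  rw [vv_eq_smul_single hp0, map_smul]
  have hw := wc_natCast_mod (p := p) lam j n
  have hr := Nat.mod_lt n hp0
  have hn := Nat.div_add_mod n p
  set q := n / p
  set r := n % p
  have hcol : ∀ k : Fin p, vermaRho K p c lam (j : ℤ) (Pi.single ⟨r, hr⟩ 1) k =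
      if r = (k : ℕ) + j then wc lam j (r : K) else 0 := by
    intro k
    have h1 : (j : ℤ) ≠ -1 := by omega
    have h2 : (j : ℤ) ≤ (p : ℤ) - 2 := by omega
    simp [vermaRho, vermaMat, h1, h2, wCoef_eq_wc]
  rw [← hw]
  rcases lt_or_ge r j with h | h
  · rw [wc_eq_zero_of_lt lam h, zero_smul]
    funext k
    rw [Pi.smul_apply, hcol]
    have h2 : r ≠ (k : ℕ) + j := by omega
    simp [h2]
  · have : n - j = (r - j) + p * q := by omega
    rw [this]
    funext k
    rw [Pi.smul_apply, hcol, Pi.smul_apply, vv, Nat.add_mul_mod_self_left,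
      Nat.add_mul_div_left _ _ hp0, Nat.mod_eq_of_lt (show r - j < p by omega),
      Nat.div_eq_of_lt (show r - j < p by omega)]
    have h3 : (k : ℕ) = r - j ↔ r = (k : ℕ) + j := by omega
    simp only [h3, zero_add]
    split_ifs <;> simp [mul_comm]

lemma vermaRho_eq_zero (c lam : K) {k : ℤ} (hk : k < -1 ∨ (p : ℤ) - 2 < k) :
    vermaRho K p c lam k = 0 := by
  have h1 : k ≠ -1 ∨ (p : ℤ) - 2 < -1 := by omega
  have h2 : ¬ (0 ≤ k ∧ k ≤ (p : ℤ) - 2) := by omega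
  by_cases h3 : k = -1
  · have : p = 0 := by omega
    subst this
    exact Subsingleton.elim _ _
  · simp [vermaRho, vermaMat, h2, h3]

variable {M : Type} [AddCommGroup M] [Module K M]

lemma ext_vv (c : K) {f g : (Fin p → K) →ₗ[K] M}
    (h : ∀ n, n < p → f (vv p c n) = g (vv p c n)) : f = g := by
  refine (Pi.basisFun K (Fin p)).ext fun i => ?_
  have := h i i.2
  rw [vv_eq_single c i.2] at this
  simpa using this

/-- The linear map on the reduced Verma module with prescribed values on `v_0, ..., v_{p-1}`. -/
noncomputable def lin (p : ℕ) (F : ℕ → M) : (Fin p → K) →ₗ[K] M :=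
  (Pi.basisFun K (Fin p)).constr K fun i => F i

lemma lin_vv_of_lt (c : K) (F : ℕ → M) {n : ℕ} (hn : n < p) : lin p F (vv p c n) = F n := by
  rw [vv_eq_single c hn, lin]
  have := (Pi.basisFun K (Fin p)).constr_basis K (fun i : Fin p => F i) ⟨n, hn⟩
  simpa only [Pi.basisFun_apply] using this

lemma lin_vv (hp : 0 < p) (c : K) (F : ℕ → M) (hF : ∀ n, F (n + p) = c • F n) (n : ℕ) :
    lin p F (vv p c n) = F n := by
  induction n using Nat.strong_induction_on with
  | _ n ih =>
    rcases lt_or_ge n p with h | h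
    · exact lin_vv_of_lt c F h
    · obtain ⟨m, rfl⟩ := Nat.exists_eq_add_of_le' h
      rw [vv_add_self hp, map_smul, ih m (by omega), hF]

end Basis

section Representations

variable {K : Type} [Field K] {p : ℕ} {E : Type} [AddCommGroup E] [Module K E]

/-- A family of endomorphisms satisfying the bracket relations of the Witt algebra. -/
structure IsRep (K : Type) [Field K] (p : ℕ) {E : Type} [AddCommGroup E] [Module K E]
    (T : ℤ → Module.End K E) : Prop where
  supp : ∀ k : ℤ, (p : ℤ) - 2 < k → T k = 0
  bracket : ∀ i j : ℤ, -1 ≤ i → -1 ≤ j → ∀ x : E,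
    T i (T j x) - T j (T i x) = ((j - i : ℤ) : K) • T (i + j) x

/-- The vectors on which the bracket relations of the nonnegative part hold. -/
def BracketAt (K : Type) [Field K] {E : Type} [AddCommGroup E] [Module K E]
    (T : ℤ → Module.End K E) (x : E) : Prop :=
  ∀ i j : ℤ, 0 ≤ i → 0 ≤ j → T i (T j x) - T j (T i x) = ((j - i : ℤ) : K) • T (i + j) x

lemma bracket_neg_one [CharP K p] {T : ℤ → Module.End K E}
    (supp : ∀ k : ℤ, (p : ℤ) - 2 < k → T k = 0)
    (h1 : ∀ j : ℤ, 0 ≤ j → j ≤ (p : ℤ) - 2 → ∀ x,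
      T (-1) (T j x) - T j (T (-1) x) = ((j + 1 : ℤ) : K) • T (j - 1) x)
    (j : ℤ) (hj : -1 ≤ j) (x : E) :
    T (-1) (T j x) - T j (T (-1) x) = ((j + 1 : ℤ) : K) • T (j - 1) x := by
  rcases eq_or_lt_of_le hj with rfl | hj
  · simp
  rcases le_or_gt j ((p : ℤ) - 2) with h | h
  · exact h1 j (by omega) h x
  · rw [supp j h]
    rcases eq_or_lt_of_le (show (p : ℤ) - 1 ≤ j by omega) with h2 | h2
    · have : ((j + 1 : ℤ) : K) = 0 := by rw [← h2]; simp
      rw [this]; simp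
    · rw [supp (j - 1) (by omega)]; simp

lemma BracketAt.step [CharP K p] {T : ℤ → Module.End K E}
    (supp : ∀ k : ℤ, (p : ℤ) - 2 < k → T k = 0)
    (h1 : ∀ j : ℤ, 0 ≤ j → j ≤ (p : ℤ) - 2 → ∀ x,
      T (-1) (T j x) - T j (T (-1) x) = ((j + 1 : ℤ) : K) • T (j - 1) x)
    {x : E} (hx : BracketAt K T x) : BracketAt K T (T (-1) x) := by
  have h1' := bracket_neg_one supp h1
  have hx' : ∀ i j : ℤ, -1 ≤ i → -1 ≤ j →
      T i (T j x) - T j (T i x) = ((j - i : ℤ) : K) • T (i + j) x := by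
    intro i j hi hj
    rcases eq_or_lt_of_le hi with rfl | hi'
    · have := h1' j hj x
      rw [this, neg_add_eq_sub, sub_neg_eq_add]
    · rcases eq_or_lt_of_le hj with rfl | hj'
      · have := h1' i hi x
        rw [← neg_sub, this, ← neg_smul]
        congr 1
        push_cast; ring
      · exact hx i j (by omega) (by omega)
  intro i j hi hj
  have key : ∀ k : ℤ, -1 ≤ k → ∀ y, T k (T (-1) y) =
      T (-1) (T k y) - ((k + 1 : ℤ) : K) • T (k - 1) y := fun k hk y => by
    rw [← h1' k hk y]; abel
  have e0 := congrArg (T (-1)) (hx' i j (by omega) (by omega))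
  have e1 := hx' (i - 1) j (by omega) (by omega)
  have e2 := hx' i (j - 1) (by omega) (by omega)
  rw [show i - 1 + j = i + j - 1 by ring] at e1
  rw [show i + (j - 1) = i + j - 1 by ring] at e2
  simp only [map_sub, map_smul] at e0
  simp only [key j (by omega), key i (by omega), key (i + j) (by omega), map_sub, map_smul]
  push_cast at e0 e1 e2 ⊢
  linear_combination (norm := module) e0 - ((i : K) + 1) • e1 - ((j : K) + 1) • e2

lemma IsRep.of_bracketAt [CharP K p] {T : ℤ → Module.End K E}
    (supp : ∀ k : ℤ, (p : ℤ) - 2 < k → T k = 0)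
    (h1 : ∀ j : ℤ, 0 ≤ j → j ≤ (p : ℤ) - 2 → ∀ x,
      T (-1) (T j x) - T j (T (-1) x) = ((j + 1 : ℤ) : K) • T (j - 1) x)
    (h : ∀ x, BracketAt K T x) : IsRep K p T := by
  refine ⟨supp, fun i j hi hj x => ?_⟩
  have h1' := bracket_neg_one supp h1
  rcases eq_or_lt_of_le hi with rfl | hi'
  · rw [h1' j hj x, neg_add_eq_sub, sub_neg_eq_add]
  · rcases eq_or_lt_of_le hj with rfl | hj'
    · rw [← neg_sub, h1' i hi x, ← neg_smul]
      congr 1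
      push_cast; ring
    · exact h x i j (by omega) (by omega)

lemma bracketAt_add {T : ℤ → Module.End K E} {x y : E} (hx : BracketAt K T x)
    (hy : BracketAt K T y) : BracketAt K T (x + y) := by
  intro i j hi hj
  simp only [map_add, smul_add]
  linear_combination (norm := module) hx i j hi hj + hy i j hi hj

/-- Iterating `ad e_i` on `e_{-1}` gives a multiple of `e_{mi-1}`. -/
lemma IsRep.ad_pow_neg_one {T : ℤ → Module.End K E} (hT : IsRep K p T) {i : ℤ} (hi : 1 ≤ i)
    (m : ℕ) : ∃ a : K, ((LinearMap.mulLeft K (T i) - LinearMap.mulRight K (T i)) ^ m) (T (-1)) =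
      a • T (m * i - 1) := by
  induction m with
  | zero => exact ⟨1, by simp⟩
  | succ m ih =>
    obtain ⟨a, ha⟩ := ih
    refine ⟨a * ((m * i - 1 - i : ℤ) : K), ?_⟩
    rw [pow_succ', Module.End.mul_apply, ha]
    ext x
    have hm : (-1 : ℤ) ≤ m * i - 1 := by nlinarith
    have := hT.bracket i (m * i - 1) (by omega) hm x
    rw [show i + (m * i - 1) = ((m + 1 : ℕ) : ℤ) * i - 1 by push_cast; ring] at this
    simp only [LinearMap.sub_apply, LinearMap.mulLeft_apply, LinearMap.mulRight_apply,
      Module.End.mul_apply, LinearMap.smul_apply, map_smul]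
    rw [this, smul_smul]

lemma IsRep.pow_commute_neg_one [CharP K p] [Fact p.Prime] [Nontrivial E]
    {T : ℤ → Module.End K E} (hT : IsRep K p T) {i : ℤ} (hi : 1 ≤ i) :
    T i ^ p * T (-1) = T (-1) * T i ^ p := by
  have : CharP (Module.End K (Module.End K E)) p :=
    charP_of_injective_algebraMap (algebraMap K (Module.End K (Module.End K E))).injective p
  obtain ⟨a, ha⟩ := hT.ad_pow_neg_one hi p
  rw [sub_pow_char_of_commute (R := Module.End K (Module.End K E)) p
    (LinearMap.commute_mulLeft_right _ _), hT.supp (p * i - 1)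
    (by nlinarith [(Fact.out : p.Prime).pos]), smul_zero, LinearMap.sub_apply,
    LinearMap.pow_mulLeft, LinearMap.pow_mulRight, sub_eq_zero] at ha
  exact ha

end Representations

section Verma

variable {K : Type} [Field K] {p : ℕ} [CharP K p]

lemma vermaRho_comm_neg_one (hp : 1 < p) (c lam : K) (j : ℤ) (hj : 0 ≤ j)
    (hj' : j ≤ (p : ℤ) - 2) (x : Fin p → K) :
    vermaRho K p c lam (-1) (vermaRho K p c lam j x) -
      vermaRho K p c lam j (vermaRho K p c lam (-1) x) =
      ((j + 1 : ℤ) : K) • vermaRho K p c lam (j - 1) x := by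
  obtain ⟨j, rfl⟩ := Int.eq_ofNat_of_zero_le hj
  have key : vermaRho K p c lam (-1) ∘ₗ vermaRho K p c lam j -
      vermaRho K p c lam j ∘ₗ vermaRho K p c lam (-1) =
      ((j + 1 : ℤ) : K) • vermaRho K p c lam (j - 1) := by
    refine ext_vv c fun n _ => ?_
    simp only [LinearMap.sub_apply, LinearMap.comp_apply, LinearMap.smul_apply,
      vermaRho_neg_one_vv hp]
    rw [vermaRho_natCast_vv hp c lam (by omega), vermaRho_natCast_vv hp c lam (by omega), map_smul,
      vermaRho_neg_one_vv hp]
    cases j with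
    | zero =>
      simp only [wc_zero, Nat.cast_zero, zero_sub, vermaRho_neg_one_vv hp, Nat.sub_zero]
      push_cast
      module
    | succ j =>
      rw [show ((j + 1 : ℕ) : ℤ) - 1 = (j : ℤ) by push_cast; ring,
        vermaRho_natCast_vv hp c lam (by omega)]
      rcases lt_or_ge n (j + 1) with h | h
      · rw [wc_eq_zero_of_lt lam h, Nat.cast_add, Nat.cast_one, wc_succ_add_one,
          wc_eq_zero_of_lt lam h, Nat.add_sub_add_right]
        push_cast
        module
      · rw [Nat.cast_add n, Nat.cast_one, wc_succ_add_one, Nat.add_sub_add_right,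
          show n - (j + 1) + 1 = n - j by omega]
        push_cast
        module
  exact LinearMap.congr_fun key x

lemma vermaRho_zero_apply (c lam : K) (hp : 1 < p) (n : ℕ) :
    vermaRho K p c lam 0 (vv p c n) = (lam - n) • vv p c n := by
  have := vermaRho_natCast_vv hp c lam (j := 0) (by omega) n
  simpa [wc_zero] using this

lemma vermaRho_vv_zero (c lam : K) (hp : 1 < p) {j : ℤ} (hj : 0 ≤ j) :
    vermaRho K p c lam j (vv p c 0) = if j = 0 then lam • vv p c 0 else 0 := by
  obtain ⟨j, rfl⟩ := Int.eq_ofNat_of_zero_le hj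
  rcases lt_or_ge ((p : ℤ) - 2) j with h | h
  · rw [vermaRho_eq_zero c lam (Or.inr h), if_neg (by omega)]; rfl
  · rw [vermaRho_natCast_vv hp c lam (by omega)]
    cases j with
    | zero => simp [wc_zero]
    | succ j =>
      rw [wc_eq_zero_of_lt lam (Nat.succ_pos j), if_neg (by omega), zero_smul]

lemma isRep_vermaRho (hp : 1 < p) (c lam : K) : IsRep K p (vermaRho K p c lam) := by
  have hs : ∀ k : ℤ, (p : ℤ) - 2 < k → vermaRho K p c lam k = 0 := fun k hk =>
    vermaRho_eq_zero c lam (Or.inr hk)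
  refine IsRep.of_bracketAt hs (vermaRho_comm_neg_one hp c lam) fun x => ?_
  have hv : ∀ n, BracketAt K (vermaRho K p c lam) (vv p c n) := by
    intro n
    induction n with
    | zero =>
      intro i j hi hj
      rw [vermaRho_vv_zero c lam hp hj, vermaRho_vv_zero c lam hp hi,
        vermaRho_vv_zero c lam hp (by omega)]
      split_ifs with h1 h2 h3 h3 h4 <;>
        simp [vermaRho_vv_zero c lam hp, hi, hj, h1] <;> try omega
      all_goals simp_all
    | succ n ih =>
      rw [← vermaRho_neg_one_vv hp c lam]
      exact ih.step hs (vermaRho_comm_neg_one hp c lam)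
  intro i j hi hj
  have : vermaRho K p c lam i ∘ₗ vermaRho K p c lam j -
      vermaRho K p c lam j ∘ₗ vermaRho K p c lam i =
      ((j - i : ℤ) : K) • vermaRho K p c lam (i + j) :=
    ext_vv c fun n _ => hv n i j hi hj
  exact LinearMap.congr_fun this x

lemma natCast_pow_char [Fact p.Prime] (n : ℕ) : (n : K) ^ p = n :=
  map_natCast (frobenius K p) n

lemma vermaRho_pow_char [Fact p.Prime] (c lam : K) {i : ℤ} (hi : -1 ≤ i)
    (hi' : i ≤ (p : ℤ) - 2) :
    vermaRho K p c lam i ^ p =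
      (if i = -1 then c else if i = 0 then lam ^ p - lam else 0) • (1 : Module.End K (Fin p → K)) +
        if i = 0 then vermaRho K p c lam 0 else 0 := by
  have hp : 1 < p := (Fact.out : p.Prime).one_lt
  refine ext_vv c fun n hn => ?_
  rcases eq_or_lt_of_le hi with rfl | hi
  · rw [vermaRho_neg_one_pow_vv hp, vv_add_self (by omega)]
    simp
  obtain ⟨j, rfl⟩ := Int.eq_ofNat_of_zero_le (show 0 ≤ i by omega)
  cases j with
  | zero =>
    have h : ∀ m, (vermaRho K p c lam 0 ^ m) (vv p c n) = (lam - n) ^ m • vv p c n := by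
      intro m
      induction m with
      | zero => simp
      | succ m ih =>
        rw [pow_succ', Module.End.mul_apply, ih, map_smul, vermaRho_zero_apply c lam hp, smul_smul,
          pow_succ]
    simp only [Nat.cast_zero]
    rw [h, sub_pow_char, natCast_pow_char]
    simp only [LinearMap.add_apply, LinearMap.smul_apply, Module.End.one_apply, if_true,
      vermaRho_zero_apply c lam hp]
    rw [if_neg (by norm_num)]
    module
  | succ j =>
    have h : ∀ m n, n < m → (vermaRho K p c lam ((j + 1 : ℕ) : ℤ) ^ m) (vv p c n) = 0 := by
      intro m
      induction m with
      | zero => intro n hn; omega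
      | succ m ih =>
        intro n hn
        rw [pow_succ, Module.End.mul_apply, vermaRho_natCast_vv hp c lam (by omega), map_smul]
        rcases lt_or_ge n (j + 1) with h | h
        · rw [wc_eq_zero_of_lt lam h, zero_smul]
        · rw [ih _ (by omega), smul_zero]
    rw [h p n hn]
    have h1 : ((j + 1 : ℕ) : ℤ) ≠ -1 := by omega
    have h2 : ((j + 1 : ℕ) : ℤ) ≠ 0 := by omega
    rw [if_neg h1, if_neg h2, if_neg h2]
    simp

end Verma

section Cocycles

variable {K : Type} [Field K] {p : ℕ} {M N : Type} [AddCommGroup M] [Module K M]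
  [AddCommGroup N] [Module K N]

/-- The off-diagonal entry of the `n`-th power of the block matrix `(a, c; 0, b)`. -/
def offDiag (a : Module.End K M) (b : Module.End K N) (c : N →ₗ[K] M) (n : ℕ) (x : N) : M :=
  ∑ k ∈ Finset.range n, (a ^ k) (c ((b ^ (n - 1 - k)) x))

lemma offDiag_succ (a : Module.End K M) (b : Module.End K N) (c : N →ₗ[K] M) (n : ℕ) (x : N) :
    offDiag a b c (n + 1) x = offDiag a b c n (b x) + (a ^ n) (c x) := by
  rw [offDiag, offDiag, Finset.sum_range_succ]
  congr 1
  · refine Finset.sum_congr rfl fun k hk => ?_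
    have := Finset.mem_range.1 hk
    rw [show n + 1 - 1 - k = (n - 1 - k) + 1 by omega, pow_succ, Module.End.mul_apply]
  · simp

lemma offDiag_coboundary (a : Module.End K M) (b : Module.End K N) (f : N →ₗ[K] M) (n : ℕ)
    (x : N) : offDiag a b (a ∘ₗ f - f ∘ₗ b) n x = (a ^ n) (f x) - f ((b ^ n) x) := by
  induction n generalizing x with
  | zero => simp [offDiag]
  | succ n ih =>
    rw [offDiag_succ, ih, pow_succ, pow_succ, Module.End.mul_apply, Module.End.mul_apply]
    simp

lemma mem_cocycles_iff {lo : ℤ} {ρM : ℤ → Module.End K M} {ρN : ℤ → Module.End K N}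
    {c : ℤ → N →ₗ[K] M} :
    c ∈ cocycles K p lo ρM ρN ↔
      (∀ k, (k < lo ∨ (p : ℤ) - 2 < k) → c k = 0) ∧
      (∀ i j, lo ≤ i → i ≤ (p : ℤ) - 2 → lo ≤ j → j ≤ (p : ℤ) - 2 → ∀ x,
        ρM i (c j x) + c i (ρN j x) - ρM j (c i x) - c j (ρN i x) =
          ((j - i : ℤ) : K) • c (i + j) x) ∧
      (∀ i, lo ≤ i → i ≤ (p : ℤ) - 2 → ∀ x,
        offDiag (ρM i) (ρN i) (c i) p x = if i = 0 then c 0 x else 0) := by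
  simp only [cocycles, Submodule.mem_inf, Submodule.mem_iInf, LinearMap.mem_ker, and_assoc]
  refine and_congr (forall_congr' fun k => ?_) (and_congr (forall_congr' fun i =>
    forall_congr' fun j => ?_) (forall_congr' fun i => ?_))
  · rw [suppConstraint]
    split_ifs with h <;> simp [h]
  · rw [bracketConstraint]
    split_ifs with h
    · simp only [h, forall_true_left, LinearMap.ext_iff]
      refine forall_congr' fun x => ?_
      simp only [LinearMap.add_apply, LinearMap.sub_apply, LinearMap.smul_apply,
        LinearMap.comp_apply, LinearMap.proj_apply, LinearMap.llcomp_apply, LinearMap.lcomp_apply,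
        LinearMap.zero_apply]
      rw [eq_comm, ← sub_eq_zero (b := _ • _), ← neg_eq_zero, neg_sub, eq_comm (b := (0 : M))]
      constructor <;> intro h <;> rw [h] <;> abel
    · simp only [LinearMap.zero_apply, true_iff]
      intro h1 h2 h3 h4
      exact absurd ⟨h1, h2, h3, h4⟩ h
  · rw [pcharConstraint]
    by_cases h : lo ≤ i ∧ i ≤ (p : ℤ) - 2
    · rw [if_pos h]
      simp only [h, forall_true_left, LinearMap.ext_iff]
      refine forall_congr' fun x => ?_
      by_cases h0 : i = 0
      · simp only [LinearMap.sub_apply, LinearMap.sum_apply,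
          LinearMap.comp_apply, LinearMap.proj_apply, LinearMap.llcomp_apply,
          LinearMap.lcomp_apply, LinearMap.zero_apply, sub_eq_zero, offDiag, h0, if_true]
      · simp only [LinearMap.sum_apply, sub_zero,
          LinearMap.comp_apply, LinearMap.proj_apply, LinearMap.llcomp_apply,
          LinearMap.lcomp_apply, LinearMap.zero_apply, offDiag, h0, if_false]
    · rw [if_neg h]
      simp only [LinearMap.zero_apply, true_iff]
      intro h1 h2
      exact absurd ⟨h1, h2⟩ h

/-- The coboundary of `f`. -/
def cobd (p : ℕ) (ρM : ℤ → Module.End K M) (ρN : ℤ → Module.End K N) (f : N →ₗ[K] M) :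
    ℤ → N →ₗ[K] M :=
  fun k => if -1 ≤ k ∧ k ≤ (p : ℤ) - 2 then ρM k ∘ₗ f - f ∘ₗ ρN k else 0

lemma mem_coboundaries_iff {ρM : ℤ → Module.End K M} {ρN : ℤ → Module.End K N}
    {c : ℤ → N →ₗ[K] M} :
    c ∈ coboundaries K p (-1) ρM ρN ↔ ∃ f, cobd p ρM ρN f = c := by
  rw [coboundaries, LinearMap.mem_range]
  refine exists_congr fun f => ?_
  have : (LinearMap.pi fun k : ℤ =>
      if -1 ≤ k ∧ k ≤ (p : ℤ) - 2 then
        LinearMap.llcomp K N M M (ρM k) - LinearMap.lcomp K M (ρN k)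
      else 0) f = cobd p ρM ρN f := by
    funext k
    simp only [LinearMap.pi_apply, cobd]
    split_ifs <;> rfl
  rw [this]

/-- The block upper triangular action on an extension. -/
def blk (ρM : ℤ → Module.End K M) (ρN : ℤ → Module.End K N) (c : ℤ → N →ₗ[K] M) (k : ℤ) :
    Module.End K (M × N) :=
  ((ρM k).coprod (c k)).prod (ρN k ∘ₗ LinearMap.snd K M N)

lemma blk_apply (ρM : ℤ → Module.End K M) (ρN : ℤ → Module.End K N) (c : ℤ → N →ₗ[K] M) (k : ℤ)
    (m : M) (x : N) : blk ρM ρN c k (m, x) = (ρM k m + c k x, ρN k x) := rfl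

lemma blk_pow_apply (ρM : ℤ → Module.End K M) (ρN : ℤ → Module.End K N) (c : ℤ → N →ₗ[K] M)
    (k : ℤ) (n : ℕ) (m : M) (x : N) :
    (blk ρM ρN c k ^ n) (m, x) =
      ((ρM k ^ n) m + offDiag (ρM k) (ρN k) (c k) n x, (ρN k ^ n) x) := by
  induction n generalizing m x with
  | zero => simp [offDiag]
  | succ n ih =>
    rw [pow_succ, Module.End.mul_apply, blk_apply, ih, offDiag_succ, pow_succ, pow_succ,
      Module.End.mul_apply, Module.End.mul_apply, map_add]
    congr 1
    abel

end Cocycles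

section VermaCocycles

variable {K : Type} [Field K] {p : ℕ} [CharP K p] [Fact p.Prime]

lemma cobd_mem_cocycles {c lam lam' : K} (hl : lam ^ p - lam = lam' ^ p - lam')
    (f : (Fin p → K) →ₗ[K] (Fin p → K)) :
    cobd p (vermaRho K p c lam) (vermaRho K p c lam') f ∈
      cocycles K p (-1) (vermaRho K p c lam) (vermaRho K p c lam') := by
  have hp : 1 < p := (Fact.out : p.Prime).one_lt
  have hM := isRep_vermaRho hp c lam
  have hN := isRep_vermaRho hp c lam'
  have happ : ∀ k x, cobd p (vermaRho K p c lam) (vermaRho K p c lam') f k x =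
      vermaRho K p c lam k (f x) - f (vermaRho K p c lam' k x) := by
    intro k x
    rw [cobd]
    split_ifs with h
    · rfl
    · have hk : k < -1 ∨ (p : ℤ) - 2 < k := by omega
      simp [vermaRho_eq_zero _ _ hk]
  refine mem_cocycles_iff.2 ⟨fun k hk => ?_, fun i j hi _ hj _ x => ?_, fun i hi hi' x => ?_⟩
  · rw [cobd, if_neg (by omega)]
  · have e1 := hM.bracket i j hi hj (f x)
    have e2 := congrArg f (hN.bracket i j hi hj x)
    simp only [happ, map_sub, map_smul] at e1 e2 ⊢
    linear_combination (norm := module) e1 - e2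
  · have : cobd p (vermaRho K p c lam) (vermaRho K p c lam') f i =
        vermaRho K p c lam i ∘ₗ f - f ∘ₗ vermaRho K p c lam' i := by
      rw [cobd, if_pos ⟨hi, hi'⟩]
    rw [this, offDiag_coboundary, vermaRho_pow_char c lam hi hi', vermaRho_pow_char c lam' hi hi',
      hl]
    by_cases h0 : i = 0
    · simp only [h0, if_true, happ, LinearMap.add_apply, map_add, LinearMap.smul_apply,
        Module.End.one_apply, map_smul]
      module
    · by_cases h1 : i = -1 <;> simp [h0, h1]

lemma mem_cocycles_of_generator {c lam lam' : K}
    {z : ℤ → (Fin p → K) →ₗ[K] (Fin p → K)}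
    (supp : ∀ k : ℤ, (k < -1 ∨ (p : ℤ) - 2 < k) → z k = 0) (hz : z (-1) = 0) (hz0 : z 0 = 0)
    (h1 : ∀ j : ℤ, 0 ≤ j → j ≤ (p : ℤ) - 2 → ∀ n, n < p →
      vermaRho K p c lam (-1) (z j (vv p c n)) - z j (vv p c (n + 1)) =
        ((j + 1 : ℤ) : K) • z (j - 1) (vv p c n))
    (hb : ∀ i j : ℤ, 0 ≤ i → 0 ≤ j →
      vermaRho K p c lam i (z j (vv p c 0)) + z i (vermaRho K p c lam' j (vv p c 0)) -
        (vermaRho K p c lam j (z i (vv p c 0)) + z j (vermaRho K p c lam' i (vv p c 0))) =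
        ((j - i : ℤ) : K) • z (i + j) (vv p c 0))
    (hc : ∀ i : ℤ, 1 ≤ i → i ≤ (p : ℤ) - 2 →
      offDiag (vermaRho K p c lam i) (vermaRho K p c lam' i) (z i) p (vv p c 0) = 0) :
    z ∈ cocycles K p (-1) (vermaRho K p c lam) (vermaRho K p c lam') := by
  have hp : 1 < p := (Fact.out : p.Prime).one_lt
  have hM := isRep_vermaRho hp c lam
  have hN := isRep_vermaRho hp c lam'
  have hMN : Nontrivial ((Fin p → K) × (Fin p → K)) := by
    have : Nonempty (Fin p) := ⟨⟨0, by omega⟩⟩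
    infer_instance
  set T := blk (vermaRho K p c lam) (vermaRho K p c lam') z with hT
  have hTs : ∀ k : ℤ, (p : ℤ) - 2 < k → T k = 0 := by
    intro k hk
    refine LinearMap.ext fun ⟨m, x⟩ => ?_
    rw [hT, blk_apply, hM.supp k hk, hN.supp k hk, supp k (Or.inr hk)]
    simp
  have h1' : ∀ j : ℤ, 0 ≤ j → j ≤ (p : ℤ) - 2 → ∀ x,
      vermaRho K p c lam (-1) (z j x) - z j (vermaRho K p c lam' (-1) x) =
        ((j + 1 : ℤ) : K) • z (j - 1) x := by
    intro j hj hj' x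
    have : vermaRho K p c lam (-1) ∘ₗ z j - z j ∘ₗ vermaRho K p c lam' (-1) =
        ((j + 1 : ℤ) : K) • z (j - 1) := by
      refine ext_vv c fun n hn => ?_
      have := h1 j hj hj' n hn
      simpa only [LinearMap.sub_apply, LinearMap.comp_apply, LinearMap.smul_apply,
        vermaRho_neg_one_vv hp] using this
    exact LinearMap.congr_fun this x
  have hT1 : ∀ j : ℤ, 0 ≤ j → j ≤ (p : ℤ) - 2 → ∀ x,
      T (-1) (T j x) - T j (T (-1) x) = ((j + 1 : ℤ) : K) • T (j - 1) x := by
    rintro j hj hj' ⟨m, x⟩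
    have e1 := hM.bracket (-1) j (by omega) (by omega) m
    have e2 := hN.bracket (-1) j (by omega) (by omega) x
    have e3 := h1' j hj hj' x
    rw [neg_add_eq_sub, sub_neg_eq_add] at e1 e2
    simp only [hT, blk_apply, hz, LinearMap.zero_apply, add_zero, map_add, Prod.mk_sub_mk,
      Prod.smul_mk, Prod.mk.injEq]
    refine ⟨?_, e2⟩
    linear_combination (norm := module) e1 + e3
  have hrep : IsRep K p T := by
    refine IsRep.of_bracketAt hTs hT1 ?_
    have hv : ∀ n, BracketAt K T (0, vv p c n) := by
      intro n
      induction n with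
      | zero =>
        intro i j hi hj
        have e2 := hN.bracket i j (by omega) (by omega) (vv p c 0)
        simp only [hT, blk_apply, map_zero, zero_add, Prod.mk_sub_mk,
          Prod.smul_mk, Prod.mk.injEq]
        exact ⟨hb i j hi hj, e2⟩
      | succ n ih =>
        have : ((0, vv p c (n + 1)) : (Fin p → K) × (Fin p → K)) = T (-1) (0, vv p c n) := by
          simp only [hT, blk_apply, hz, map_zero, LinearMap.zero_apply, add_zero,
            vermaRho_neg_one_vv hp]
        rw [this]
        exact ih.step hTs hT1
    have hx : ∀ x, BracketAt K T (0, x) := by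
      intro x i j hi hj
      have : (T i ∘ₗ T j - T j ∘ₗ T i) ∘ₗ LinearMap.inr K (Fin p → K) (Fin p → K) =
          (((j - i : ℤ) : K) • T (i + j)) ∘ₗ LinearMap.inr K (Fin p → K) (Fin p → K) :=
        ext_vv c fun n _ => hv n i j hi hj
      exact LinearMap.congr_fun this x
    rintro ⟨m, x⟩
    have hm : BracketAt K T (m, 0) := by
      intro i j hi hj
      have e1 := hM.bracket i j (by omega) (by omega) m
      simp only [hT, blk_apply, map_zero, add_zero, Prod.mk_sub_mk,
        Prod.smul_mk, Prod.mk.injEq, sub_zero, smul_zero, and_true]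
      exact e1
    simpa using bracketAt_add hm (hx x)
  refine mem_cocycles_iff.2 ⟨supp, fun i j hi _ hj _ x => ?_, fun i hi hi' x => ?_⟩
  · have := congrArg Prod.fst (hrep.bracket i j hi hj (0, x))
    simp only [hT, blk_apply, map_zero, zero_add, Prod.fst_sub, Prod.smul_fst] at this
    rw [← this]
    abel
  · rcases lt_or_ge i 1 with h | h
    · have hzi : z i = 0 := by
        rcases show i = -1 ∨ i = 0 by omega with rfl | rfl <;> assumption
      rw [hzi, hz0]
      simp [offDiag]
    · rw [if_neg (by omega)]
      have hcomm : ∀ x, offDiag (vermaRho K p c lam i) (vermaRho K p c lam' i) (z i) p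
          (vermaRho K p c lam' (-1) x) = vermaRho K p c lam (-1)
            (offDiag (vermaRho K p c lam i) (vermaRho K p c lam' i) (z i) p x) := by
        intro x
        have := congrArg Prod.fst
          (LinearMap.congr_fun (hrep.pow_commute_neg_one h) ((0 : Fin p → K), x))
        simpa only [hT, Module.End.mul_apply, blk_apply, blk_pow_apply, hz, map_zero,
          LinearMap.zero_apply, zero_add, add_zero] using this
      have hv : ∀ n, offDiag (vermaRho K p c lam i) (vermaRho K p c lam' i) (z i) p
          (vv p c n) = 0 := by
        intro n
        induction n with
        | zero => exact hc i h hi'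
        | succ n ih => rw [← vermaRho_neg_one_vv hp c lam', hcomm, ih, map_zero]
      have : ∑ k ∈ Finset.range p, (vermaRho K p c lam i ^ k) ∘ₗ z i ∘ₗ
          (vermaRho K p c lam' i ^ (p - 1 - k)) = 0 := by
        refine ext_vv c fun n _ => ?_
        rw [LinearMap.sum_apply]
        exact hv n
      have := LinearMap.congr_fun this x
      rw [LinearMap.sum_apply] at this
      exact this

end VermaCocycles

section Normalization

variable {K : Type} [Field K] {p : ℕ}

/-- The index below `p` congruent to `d - j`. -/
def ix (p d j : ℕ) : ℕ := (d + (p - 1) * j) % p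

lemma ix_lt (hp : 0 < p) (d j : ℕ) : ix p d j < p := Nat.mod_lt _ hp

lemma natCast_inj_of_lt [CharP K p] {m n : ℕ} (hm : m < p) (hn : n < p) (h : (m : K) = n) :
    m = n := CharP.natCast_injOn_Iio K p hm hn h

lemma ix_cast [CharP K p] (hp : 0 < p) (d j : ℕ) : ((ix p d j : ℕ) : K) = (d : K) - j := by
  have h : ((ix p d j : ℕ) : K) = ((d + (p - 1) * j : ℕ) : K) := by
    conv_rhs => rw [← Nat.div_add_mod (d + (p - 1) * j) p]
    simp [ix]
  rw [h, Nat.cast_add, Nat.cast_mul, Nat.cast_pred hp, CharP.cast_eq_zero K p]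
  ring

lemma vermaRho_vv_ix [CharP K p] (hp : 1 < p) (c lam : K) {i : ℕ} (hi : i + 2 ≤ p) (d j : ℕ) :
    vermaRho K p c lam (i : ℤ) (vv p c (ix p d j)) =
      wc lam i ((d : K) - j) • vv p c (ix p d (i + j)) := by
  have hp0 : 0 < p := by omega
  rw [vermaRho_natCast_vv hp c lam hi, ← ix_cast hp0]
  rcases lt_or_ge (ix p d j) i with h | h
  · rw [wc_eq_zero_of_lt lam h, zero_smul, zero_smul]
  · congr 2
    refine natCast_inj_of_lt (K := K) (p := p) (by have := ix_lt hp0 d j; omega)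
      (ix_lt hp0 d _) ?_
    rw [Nat.cast_sub h, ix_cast hp0, ix_cast hp0]
    push_cast
    ring

lemma ix_zero {d : ℕ} (hd : d < p) : ix p d 0 = d := by
  rw [ix, Nat.mul_zero, Nat.add_zero, Nat.mod_eq_of_lt hd]

lemma vv_ne_zero (c : K) {n : ℕ} (hn : n < p) : vv p c n ≠ 0 := by
  rw [vv_eq_single c hn]
  simp

lemma vermaRho_zero_coord [CharP K p] (hp : 1 < p) (c lam : K) (x : Fin p → K) (k : Fin p) :
    vermaRho K p c lam 0 x k = (lam - (k : ℕ)) * x k := by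
  have : LinearMap.proj k ∘ₗ vermaRho K p c lam 0 =
      (lam - (k : ℕ)) • (LinearMap.proj k : (Fin p → K) →ₗ[K] K) := by
    refine ext_vv c fun n hn => ?_
    rw [LinearMap.comp_apply, vermaRho_zero_apply c lam hp, LinearMap.proj_apply,
      LinearMap.smul_apply, LinearMap.proj_apply, vv_eq_single c hn, Pi.smul_apply, smul_eq_mul,
      smul_eq_mul]
    rcases eq_or_ne k ⟨n, hn⟩ with rfl | h
    · rfl
    · simp [h]
  exact LinearMap.congr_fun this x

lemma eq_smul_vv_of_coord (c : K) {x : Fin p → K} {n : ℕ} (hn : n < p)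
    (h : ∀ k : Fin p, (k : ℕ) ≠ n → x k = 0) : x = x ⟨n, hn⟩ • vv p c n := by
  funext k
  rw [vv_eq_single c hn]
  rcases eq_or_ne k ⟨n, hn⟩ with rfl | hk
  · simp
  · rw [h k fun h' => hk (Fin.ext h')]
    simp [hk]

lemma exists_smul_of_weight [CharP K p] (hp : 1 < p) {c lam mu : K} {x : Fin p → K} {n : ℕ}
    (hn : n < p) (hx : vermaRho K p c lam 0 x = mu • x) (hmu : (n : K) = lam - mu) :
    ∃ t : K, x = t • vv p c n := by
  refine ⟨_, eq_smul_vv_of_coord c hn fun k hk => ?_⟩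
  have h := congrFun hx k
  rw [vermaRho_zero_coord hp, Pi.smul_apply, smul_eq_mul] at h
  have h2 : ((n : K) - (k : ℕ)) * x k = 0 := by rw [hmu]; linear_combination h
  refine (mul_eq_zero.1 h2).resolve_left fun h3 => hk ?_
  exact natCast_inj_of_lt (K := K) k.2 hn (sub_eq_zero.1 h3).symm

/-- A cocycle vanishing on `e_{-1}` whose values at `v_0` are weight vectors with coordinates
`a j`, and with `a 0 = 0`. -/
structure HasData (p : ℕ) (c lam lam' : K) (d : ℕ) (z : ℤ → (Fin p → K) →ₗ[K] (Fin p → K))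
    (a : ℕ → K) : Prop where
  mem : z ∈ cocycles K p (-1) (vermaRho K p c lam) (vermaRho K p c lam')
  neg_one : z (-1) = 0
  apply_zero : ∀ j : ℕ, z j (vv p c 0) = a j • vv p c (ix p d j)
  zero : a 0 = 0
  large : ∀ j, p < j + 2 → a j = 0

variable {c lam lam' : K} {d : ℕ} {z z' : ℤ → (Fin p → K) →ₗ[K] (Fin p → K)} {a a' : ℕ → K}

lemma HasData.sub_smul (h : HasData p c lam lam' d z a) (h' : HasData p c lam lam' d z' a')
    (t : K) : HasData p c lam lam' d (z - t • z') (a - t • a') where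
  mem := Submodule.sub_mem _ h.mem (Submodule.smul_mem _ _ h'.mem)
  neg_one := by simp [h.neg_one, h'.neg_one]
  apply_zero j := by
    simp only [Pi.sub_apply, Pi.smul_apply, LinearMap.sub_apply, LinearMap.smul_apply,
      h.apply_zero, h'.apply_zero, smul_eq_mul]
    module
  zero := by simp [h.zero, h'.zero]
  large j hj := by simp [h.large j hj, h'.large j hj]

lemma cobd_apply (f : (Fin p → K) →ₗ[K] (Fin p → K)) (k : ℤ) (x : Fin p → K) :
    cobd p (vermaRho K p c lam) (vermaRho K p c lam') f k x =
      vermaRho K p c lam k (f x) - f (vermaRho K p c lam' k x) := by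
  rw [cobd]
  split_ifs with h
  · rfl
  · have hk : k < -1 ∨ (p : ℤ) - 2 < k := by omega
    simp [vermaRho_eq_zero _ _ hk]

variable [CharP K p]

lemma HasData.relation (h : HasData p c lam lam' d z a) {i j : ℕ} (hi : 1 ≤ i) (hi' : i + 2 ≤ p)
    (hj : 1 ≤ j) (hj' : j + 2 ≤ p) :
    ((j : K) - i) * a (i + j) = a j * wc lam i ((d : K) - j) - a i * wc lam j ((d : K) - i) := by
  have hp : 1 < p := by omega
  have hb := (mem_cocycles_iff.1 h.mem).2.1 i j (by omega) (by omega) (by omega) (by omega)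
    (vv p c 0)
  rw [vermaRho_vv_zero c lam' hp (by omega), vermaRho_vv_zero c lam' hp (by omega),
    if_neg (by omega), if_neg (by omega), map_zero, map_zero, ← Nat.cast_add, h.apply_zero,
    h.apply_zero, h.apply_zero, map_smul, map_smul, vermaRho_vv_ix hp c lam hi',
    vermaRho_vv_ix hp c lam hj', add_comm j i] at hb
  have hv := vv_ne_zero c (ix_lt (p := p) (by omega) d (i + j))
  refine smul_left_injective K hv ?_
  push_cast at hb
  simp only
  linear_combination (norm := module) -hb

lemma HasData.eq_zero [Fact p.Prime] (h : HasData p c lam lam' d z a) (h1 : a 1 = 0)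
    (h2 : a 2 = 0) : z = 0 := by
  have hp : 1 < p := (Fact.out : p.Prime).one_lt
  have ha : ∀ j, a j = 0 := by
    intro j
    induction j with
    | zero => exact h.zero
    | succ j ih =>
      rcases lt_or_ge p (j + 1 + 2) with hj | hj
      · exact h.large _ hj
      · rcases show j = 0 ∨ j = 1 ∨ 2 ≤ j by omega with rfl | rfl | hj2
        · exact h1
        · exact h2
        · have hr := h.relation (i := 1) le_rfl (by omega) (j := j) (by omega) (by omega)
          rw [ih, h1, zero_mul, zero_mul, sub_zero, add_comm] at hr
          refine (mul_eq_zero.1 hr).resolve_left fun h0 => ?_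
          have := natCast_inj_of_lt (K := K) (p := p) (by omega) (by omega) (sub_eq_zero.1 h0)
          omega
  obtain ⟨hs, hb, -⟩ := mem_cocycles_iff.1 h.mem
  have hz : ∀ n : ℕ, ∀ j : ℤ, z j (vv p c n) = 0 := by
    intro n
    induction n with
    | zero =>
      intro j
      rcases lt_or_ge j 0 with hj | hj
      · rcases eq_or_ne j (-1) with rfl | hj1
        · rw [h.neg_one]; rfl
        · rw [hs j (by omega)]; rfl
      · obtain ⟨j, rfl⟩ := Int.eq_ofNat_of_zero_le hj
        rw [h.apply_zero, ha, zero_smul]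
    | succ n ih =>
      intro j
      by_cases hj : -1 ≤ j ∧ j ≤ (p : ℤ) - 2
      · have := hb (-1) j le_rfl (by omega) hj.1 hj.2 (vv p c n)
        rw [ih, ih, ih, vermaRho_neg_one_vv hp, h.neg_one] at this
        simpa using this
      · rw [hs j (by omega)]; rfl
  funext j
  exact ext_vv c fun n _ => by rw [hz]; rfl

lemma coord_pair_of_cobd (hd : d < p) (hdval : (d : K) = lam - lam') (hp3 : 3 < p)
    (h : HasData p c lam lam' d z a) {f : (Fin p → K) →ₗ[K] (Fin p → K)}
    (hf : cobd p (vermaRho K p c lam) (vermaRho K p c lam') f = z) :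
    ∃ t : K, a 1 = t * wc lam 1 d ∧ a 2 = t * wc lam 2 d := by
  have hp : 1 < p := by omega
  have happ : ∀ j : ℕ, j + 2 ≤ p → vermaRho K p c lam j (f (vv p c 0)) -
      f (vermaRho K p c lam' j (vv p c 0)) = a j • vv p c (ix p d j) := by
    intro j hj
    rw [← h.apply_zero, ← hf, cobd, if_pos (by omega)]
    rfl
  have h0 := happ 0 (by omega)
  rw [h.zero, zero_smul, Nat.cast_zero, vermaRho_vv_zero c lam' hp le_rfl, if_pos rfl, map_smul,
    sub_eq_zero] at h0
  obtain ⟨t, ht⟩ := exists_smul_of_weight hp hd h0 hdval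
  have key : ∀ j : ℕ, 1 ≤ j → j + 2 ≤ p → a j = t * wc lam j d := by
    intro j hj1 hj
    have := happ j hj
    have hix := vermaRho_vv_ix hp c lam hj d 0
    rw [ix_zero hd, Nat.cast_zero, sub_zero, add_zero] at hix
    rw [ht, map_smul, hix, vermaRho_vv_zero c lam' hp (by omega), if_neg (by omega), map_zero,
      sub_zero, smul_smul] at this
    exact (smul_left_injective K (vv_ne_zero c (ix_lt (p := p) (by omega) d j)) this).symm
  exact ⟨t, key 1 le_rfl (by omega), key 2 (by omega) (by omega)⟩

lemma cobd_neg_one_eq_zero [Fact p.Prime] (m : Fin p → K) :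
    cobd p (vermaRho K p c lam) (vermaRho K p c lam')
      (lin p fun n => (vermaRho K p c lam (-1) ^ n) m) (-1) = 0 := by
  have hp : 1 < p := (Fact.out : p.Prime).one_lt
  have hF : ∀ n, (vermaRho K p c lam (-1) ^ (n + p)) m = c • (vermaRho K p c lam (-1) ^ n) m := by
    intro n
    rw [pow_add, vermaRho_pow_char c lam le_rfl (by omega)]
    simp
  refine ext_vv c fun n _ => ?_
  rw [cobd_apply, vermaRho_neg_one_vv hp, lin_vv (by omega) c _ hF, lin_vv (by omega) c _ hF,
    pow_succ', Module.End.mul_apply, sub_self]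
  rfl

/-- The coboundary of the map commuting with `e_{-1}` and sending `v_0` to `v_d`. -/
lemma hasData_cobd [Fact p.Prime] (hd : d < p) (hdval : (d : K) = lam - lam')
    (hl : lam ^ p - lam = lam' ^ p - lam') :
    HasData p c lam lam' d (cobd p (vermaRho K p c lam) (vermaRho K p c lam')
      (lin p fun n => (vermaRho K p c lam (-1) ^ n) (vv p c d)))
      (fun j => if 1 ≤ j ∧ j + 2 ≤ p then wc lam j d else 0) := by
  have hp : 1 < p := (Fact.out : p.Prime).one_lt
  refine ⟨cobd_mem_cocycles hl _, cobd_neg_one_eq_zero _, fun j => ?_, by simp, fun j hj => ?_⟩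
  · rw [cobd_apply]
    split_ifs with h
    · have hix := vermaRho_vv_ix hp c lam h.2 d 0
      rw [ix_zero hd, Nat.cast_zero, sub_zero, add_zero] at hix
      rw [vermaRho_vv_zero c lam' hp (by omega), if_neg (by omega), map_zero, sub_zero,
        lin_vv_of_lt c _ (by omega), pow_zero, Module.End.one_apply, hix]
    · rcases Nat.eq_zero_or_pos j with rfl | hj
      · rw [Nat.cast_zero, vermaRho_vv_zero c lam' hp le_rfl, if_pos rfl, map_smul,
          lin_vv_of_lt c _ (by omega), pow_zero, Module.End.one_apply,
          vermaRho_zero_apply c lam hp, hdval]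
        module
      · have hk : ((j : ℤ) < -1 ∨ (p : ℤ) - 2 < j) := by omega
        simp [vermaRho_eq_zero _ _ hk]
  · rw [if_neg (by omega)]

lemma exists_hasData [Fact p.Prime] (hd : d < p) (hdval : (d : K) = lam - lam')
    (hl : lam ^ p - lam = lam' ^ p - lam')
    (hz : z ∈ cocycles K p (-1) (vermaRho K p c lam) (vermaRho K p c lam')) :
    ∃ f a, HasData p c lam lam' d
      (z - cobd p (vermaRho K p c lam) (vermaRho K p c lam') f) a := by
  have hp : 1 < p := (Fact.out : p.Prime).one_lt
  let F : ℕ → (Fin p → K) := fun n => Nat.rec 0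
    (fun n x => vermaRho K p c lam (-1) x - z (-1) (vv p c n)) n
  set z1 := z - cobd p (vermaRho K p c lam) (vermaRho K p c lam') (lin p F) with hz1
  have hmem1 : z1 ∈ cocycles K p (-1) (vermaRho K p c lam) (vermaRho K p c lam') :=
    Submodule.sub_mem _ hz (cobd_mem_cocycles hl _)
  have hlow : ∀ n, n + 1 < p → z1 (-1) (vv p c n) = 0 := by
    intro n hn
    rw [hz1, Pi.sub_apply, LinearMap.sub_apply, cobd_apply, vermaRho_neg_one_vv hp,
      lin_vv_of_lt c _ hn, lin_vv_of_lt c _ (by omega)]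
    change z (-1) (vv p c n) - (vermaRho K p c lam (-1) (F n) -
      (vermaRho K p c lam (-1) (F n) - z (-1) (vv p c n))) = 0
    abel
  have h1 : z1 (-1) = 0 := by
    refine ext_vv c fun n hn => ?_
    rcases lt_or_ge (n + 1) p with h | h
    · rw [hlow n h]; rfl
    · have hpc := (mem_cocycles_iff.1 hmem1).2.2 (-1) le_rfl (by omega) (vv p c 0)
      rw [if_neg (by omega), offDiag, Finset.sum_eq_single 0] at hpc
      · rw [vermaRho_neg_one_pow_vv hp, pow_zero, Module.End.one_apply,
          show 0 + (p - 1 - 0) = n by omega] at hpc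
        rw [hpc]; rfl
      · intro k hk hk0
        rw [vermaRho_neg_one_pow_vv hp, hlow _ (by have := Finset.mem_range.1 hk; omega), map_zero]
      · intro h
        exact absurd (Finset.mem_range.2 (by omega)) h
  let m : Fin p → K := fun k => z1 0 (vv p c 0) k / ((d : K) - (k : ℕ))
  set g : (Fin p → K) →ₗ[K] (Fin p → K) :=
    lin p fun n => (vermaRho K p c lam (-1) ^ n) m with hg
  set z2 := z1 - cobd p (vermaRho K p c lam) (vermaRho K p c lam') g with hz2
  have hmem2 : z2 ∈ cocycles K p (-1) (vermaRho K p c lam) (vermaRho K p c lam') :=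
    Submodule.sub_mem _ hmem1 (cobd_mem_cocycles hl _)
  have h2 : z2 (-1) = 0 := by
    rw [hz2, Pi.sub_apply, h1, hg, cobd_neg_one_eq_zero, sub_zero]
  have hg0 : g (vv p c 0) = m := by
    rw [hg, lin_vv_of_lt c _ (by omega), pow_zero, Module.End.one_apply]
  have h20 : z2 0 (vv p c 0) = 0 := by
    obtain ⟨t, ht⟩ : ∃ t : K, z2 0 (vv p c 0) = t • vv p c d := by
      refine ⟨_, eq_smul_vv_of_coord c hd fun k hk => ?_⟩
      have hne : (d : K) - (k : ℕ) ≠ 0 := fun h =>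
        hk (natCast_inj_of_lt (K := K) k.2 hd (sub_eq_zero.1 h).symm)
      rw [hz2, Pi.sub_apply, LinearMap.sub_apply, cobd_apply, vermaRho_vv_zero c lam' hp le_rfl,
        if_pos rfl, map_smul, hg0, Pi.sub_apply, Pi.sub_apply, vermaRho_zero_coord hp,
        Pi.smul_apply, smul_eq_mul]
      have : ((d : K) - (k : ℕ)) * m k = z1 0 (vv p c 0) k := mul_div_cancel₀ _ hne
      rw [← this, hdval]
      ring
    have hpc := (mem_cocycles_iff.1 hmem2).2.2 0 (by omega) (by omega) (vv p c 0)
    have hN : ∀ n, (vermaRho K p c lam' 0 ^ n) (vv p c 0) = lam' ^ n • vv p c 0 := by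
      intro n
      induction n with
      | zero => simp
      | succ n ih =>
        rw [pow_succ', Module.End.mul_apply, ih, map_smul, vermaRho_vv_zero c lam' hp le_rfl,
          if_pos rfl, smul_smul, pow_succ]
    have hM : ∀ n, (vermaRho K p c lam 0 ^ n) (vv p c d) = lam' ^ n • vv p c d := by
      intro n
      induction n with
      | zero => simp
      | succ n ih =>
        rw [pow_succ', Module.End.mul_apply, ih, map_smul, vermaRho_zero_apply c lam hp,
          smul_smul, pow_succ, hdval]
        congr 1
        ring
    rw [if_pos rfl, offDiag, Finset.sum_congr rfl (g := fun _ => (lam' ^ (p - 1) * t) • vv p c d),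
      Finset.sum_const, Finset.card_range, ← Nat.cast_smul_eq_nsmul K p, CharP.cast_eq_zero K p,
      zero_smul] at hpc
    · exact hpc.symm
    · intro k hk
      have := Finset.mem_range.1 hk
      rw [hN, map_smul, ht, map_smul, map_smul, hM, smul_smul, smul_smul,
        show p - 1 = (p - 1 - k) + k by omega, pow_add, Nat.add_sub_cancel]
      congr 1
      ring
  have hw : ∀ j : ℕ, ∃ t : K, z2 j (vv p c 0) = t • vv p c (ix p d j) ∧
      (j = 0 ∨ p < j + 2 → t = 0) := by
    intro j
    by_cases hj0 : j = 0 ∨ p < j + 2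
    · refine ⟨0, ?_, fun _ => rfl⟩
      rw [zero_smul]
      rcases hj0 with rfl | hj
      · exact h20
      · rw [(mem_cocycles_iff.1 hmem2).1 j (by omega)]; rfl
    · have hb := (mem_cocycles_iff.1 hmem2).2.1 0 j (by omega) (by omega) (by omega) (by omega)
        (vv p c 0)
      rw [h20, map_zero, vermaRho_vv_zero c lam' hp (by omega), if_neg (by omega), map_zero,
        vermaRho_vv_zero c lam' hp le_rfl, if_pos rfl, map_smul, zero_add, sub_zero, add_zero,
        sub_zero, sub_eq_iff_eq_add, ← add_smul] at hb
      obtain ⟨t, ht⟩ := exists_smul_of_weight hp (ix_lt (by omega) d j) hb (by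
        rw [ix_cast (by omega), hdval]; push_cast; ring)
      exact ⟨t, ht, fun h => absurd h hj0⟩
  choose a ha ha0 using hw
  refine ⟨lin p F + g, a, ?_⟩
  have hsum : z - cobd p (vermaRho K p c lam) (vermaRho K p c lam') (lin p F + g) = z2 := by
    funext k
    refine LinearMap.ext fun x => ?_
    simp only [hz2, hz1, Pi.sub_apply, LinearMap.sub_apply, cobd_apply, LinearMap.add_apply,
      map_add]
    abel
  rw [hsum]
  exact ⟨hmem2, h2, ha, ha0 0 (Or.inl rfl), fun j hj => ha0 j (Or.inr hj)⟩

end Normalization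

section Existence

variable {K : Type} [Field K] {p : ℕ} {M : Type} [AddCommGroup M] [Module K M]

/-- The shift `X ↦ (j ↦ (j + 1) X_{j-1})` on sequences. -/
def wShift (K : Type) [Field K] (M : Type) [AddCommGroup M] [Module K M] :
    Module.End K (ℕ → M) :=
  LinearMap.pi fun j => if j = 0 then 0 else ((j : K) + 1) • LinearMap.proj (j - 1)

lemma wShift_apply_zero (X : ℕ → M) : wShift K M X 0 = 0 := by simp [wShift]

lemma wShift_apply_succ (X : ℕ → M) (j : ℕ) :
    wShift K M X (j + 1) = ((j : K) + 2) • X j := by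
  simp only [wShift, LinearMap.pi_apply, if_neg (Nat.succ_ne_zero j), LinearMap.smul_apply,
    LinearMap.proj_apply, Nat.add_sub_cancel]
  congr 1
  push_cast
  ring

lemma wShift_pow_apply (X : ℕ → M) {n j : ℕ} (h : j < n) : (wShift K M ^ n) X j = 0 := by
  induction n generalizing j with
  | zero => omega
  | succ n ih =>
    rw [pow_succ', Module.End.mul_apply]
    cases j with
    | zero => rw [wShift_apply_zero]
    | succ j => rw [wShift_apply_succ, ih (by omega), smul_zero]

lemma compLeft_pow_apply (A : Module.End K M) (X : ℕ → M) (n j : ℕ) :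
    ((A.compLeft ℕ : Module.End K (ℕ → M)) ^ n) X j = (A ^ n) (X j) := by
  induction n with
  | zero => rfl
  | succ n ih =>
    rw [pow_succ', pow_succ', Module.End.mul_apply, Module.End.mul_apply, ← ih]
    rfl

lemma compLeft_sub_wShift_pow_char [CharP K p] [Fact p.Prime] [Nontrivial M]
    (A : Module.End K M) (X : ℕ → M) {j : ℕ} (hj : j < p) :
    (((A.compLeft ℕ : Module.End K (ℕ → M)) - wShift K M) ^ p) X j = (A ^ p) (X j) := by
  have : CharP (Module.End K (ℕ → M)) p :=
    charP_of_injective_algebraMap (algebraMap K (Module.End K (ℕ → M))).injective p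
  have hcomm : Commute (A.compLeft ℕ : Module.End K (ℕ → M)) (wShift K M) := by
    refine LinearMap.ext fun Y => funext fun i => ?_
    rw [Module.End.mul_apply, Module.End.mul_apply]
    change A (wShift K M Y i) = _
    cases i with
    | zero => rw [wShift_apply_zero, wShift_apply_zero, map_zero]
    | succ i => rw [wShift_apply_succ, wShift_apply_succ, map_smul]; rfl
  rw [sub_pow_char_of_commute (R := Module.End K (ℕ → M)) p hcomm, LinearMap.sub_apply,
    Pi.sub_apply, wShift_pow_apply X hj, sub_zero, compLeft_pow_apply]

variable [CharP K p]

lemma vermaRho_pow_vv_eq_zero (c lam : K) {i : ℕ} (hi : 1 ≤ i) (hi' : i + 2 ≤ p) {m n : ℕ}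
    (h : m < n) : (vermaRho K p c lam i ^ n) (vv p c m) = 0 := by
  induction n generalizing m with
  | zero => omega
  | succ n ih =>
    rw [pow_succ, Module.End.mul_apply, vermaRho_natCast_vv (by omega) c lam hi', map_smul]
    rcases lt_or_ge m i with hm | hm
    · rw [wc_eq_zero_of_lt lam hm, zero_smul]
    · rw [ih (by omega), smul_zero]

/-- A cocycle with prescribed values at `v_0`, when these satisfy the bracket relations. -/
lemma exists_hasData_of_relation [Fact p.Prime] {c lam lam' : K} {d : ℕ} (hd : d + 2 ≤ p)
    (hdval : (d : K) = lam - lam') {a : ℕ → K} (ha0 : a 0 = 0) (ha : ∀ j, d < j → a j = 0)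
    (hrel : ∀ i j, 1 ≤ i → 1 ≤ j → i + j ≤ d → ((j : K) - i) * a (i + j) =
      a j * wc lam i ((d : K) - j) - a i * wc lam j ((d : K) - i)) :
    ∃ z, HasData p c lam lam' d z a := by
  have hp : 1 < p := (Fact.out : p.Prime).one_lt
  have hnt : Nontrivial (Fin p → K) := by
    have : Nonempty (Fin p) := ⟨⟨0, by omega⟩⟩
    infer_instance
  set A := vermaRho K p c lam (-1) with hA
  set S : Module.End K (ℕ → Fin p → K) := A.compLeft ℕ - wShift K (Fin p → K) with hS
  let X : ℕ → Fin p → K := fun j => a j • vv p c (ix p d j)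
  let F : ℕ → ℕ → Fin p → K := fun j n => (S ^ n) X j
  have hF0 : ∀ j, F j 0 = a j • vv p c (ix p d j) := fun j => rfl
  have hFz : ∀ n, F 0 (n + 1) = A (F 0 n) := by
    intro n
    change (S ^ (n + 1)) X 0 = _
    rw [pow_succ', Module.End.mul_apply, hS, LinearMap.sub_apply, Pi.sub_apply, wShift_apply_zero,
      sub_zero]
    rfl
  have hFs : ∀ j n, F (j + 1) (n + 1) = A (F (j + 1) n) - ((j : K) + 2) • F j n := by
    intro j n
    change (S ^ (n + 1)) X (j + 1) = _
    rw [pow_succ', Module.End.mul_apply, hS, LinearMap.sub_apply, Pi.sub_apply, wShift_apply_succ]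
    rfl
  have hFp : ∀ j, j < p → ∀ n, F j (n + p) = c • F j n := by
    intro j hj n
    change (S ^ (n + p)) X j = c • (S ^ n) X j
    rw [add_comm, pow_add, Module.End.mul_apply, hS, compLeft_sub_wShift_pow_char _ _ hj, hA,
      vermaRho_pow_char c lam le_rfl (by omega)]
    simp
  have hF00 : ∀ n, F 0 n = 0 := by
    intro n
    induction n with
    | zero => rw [hF0, ha0, zero_smul]
    | succ n ih => rw [hFz, ih, map_zero]
  let z : ℤ → (Fin p → K) →ₗ[K] (Fin p → K) := fun k =>
    if 0 ≤ k ∧ k ≤ (p : ℤ) - 2 then lin p (F k.toNat) else 0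
  have hzF : ∀ j : ℕ, j + 2 ≤ p → ∀ n, z j (vv p c n) = F j n := by
    intro j hj n
    simp only [z]
    rw [if_pos (by omega), Int.toNat_natCast, lin_vv (by omega) c _ (hFp j (by omega))]
  have hzout : ∀ k : ℤ, ¬ (0 ≤ k ∧ k ≤ (p : ℤ) - 2) → z k = 0 := fun k hk => if_neg hk
  have hz0 : z 0 = 0 := ext_vv c fun n _ => by
    have := hzF 0 (by omega) n
    rw [Nat.cast_zero] at this
    rw [this, hF00]; rfl
  have hzv : ∀ j : ℕ, z j (vv p c 0) = a j • vv p c (ix p d j) := by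
    intro j
    rcases lt_or_ge p (j + 2) with h | h
    · rw [hzout j (by omega), ha j (by omega), zero_smul]; rfl
    · rw [hzF j h, hF0]
  have hact : ∀ i j : ℕ, 1 ≤ i → 1 ≤ j → vermaRho K p c lam i (z j (vv p c 0)) =
      (if i + j ≤ d then a j * wc lam i ((d : K) - j) else 0) • vv p c (ix p d (i + j)) := by
    intro i j hi hj
    rw [hzv, map_smul]
    rcases lt_or_ge d j with h | h
    · rw [ha j h, if_neg (by omega), zero_smul, zero_smul]
    rcases lt_or_ge p (i + 2) with hi' | hi'
    · rw [vermaRho_eq_zero c lam (Or.inr (by omega)), if_neg (by omega), zero_smul,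
        LinearMap.zero_apply, smul_zero]
    rw [vermaRho_vv_ix hp c lam hi', smul_smul]
    split_ifs with hij
    · rfl
    · rw [← Nat.cast_sub h, wc_eq_zero_of_lt lam (by omega), mul_zero]
  have hb0 : ∀ j : ℕ, vermaRho K p c lam 0 (z j (vv p c 0)) =
      (lam' + j) • z j (vv p c 0) := by
    intro j
    have := vermaRho_vv_ix hp c lam (i := 0) (by omega) d j
    rw [Nat.cast_zero, wc_zero, zero_add] at this
    rw [hzv, map_smul, this, hdval]
    module
  refine ⟨z, mem_cocycles_of_generator (fun k hk => hzout k (by omega)) (hzout _ (by omega)) hz0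
    ?_ ?_ ?_, hzout _ (by omega), hzv, ha0, fun j hj => ha j (by omega)⟩
  · intro j hj hj' n hn
    obtain ⟨j, rfl⟩ := Int.eq_ofNat_of_zero_le hj
    rw [hzF j (by omega), hzF j (by omega)]
    cases j with
    | zero => rw [hFz, sub_self, hzout _ (by simp)]; simp
    | succ j =>
      rw [hFs, sub_sub_cancel, show ((j + 1 : ℕ) : ℤ) - 1 = (j : ℕ) by push_cast; ring,
        hzF j (by omega)]
      congr 1
      push_cast
      ring
  · intro i j hi hj
    obtain ⟨i, rfl⟩ := Int.eq_ofNat_of_zero_le hi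
    obtain ⟨j, rfl⟩ := Int.eq_ofNat_of_zero_le hj
    rw [vermaRho_vv_zero c lam' hp hj, vermaRho_vv_zero c lam' hp hi]
    rcases Nat.eq_zero_or_pos i with rfl | hi1 <;> rcases Nat.eq_zero_or_pos j with rfl | hj1
    · simp
    · rw [Nat.cast_zero, hb0, hz0, if_neg (by omega), if_pos rfl, map_smul, zero_add]
      simp only [LinearMap.zero_apply, map_zero]
      push_cast
      module
    · rw [Nat.cast_zero, hb0, hz0, if_neg (Nat.cast_ne_zero.2 hi1.ne'), if_pos rfl, map_smul,
        add_zero]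
      simp only [LinearMap.zero_apply, map_zero]
      push_cast
      module
    · rw [hact i j hi1 hj1, hact j i hj1 hi1, if_neg (Nat.cast_ne_zero.2 hj1.ne'),
        if_neg (Nat.cast_ne_zero.2 hi1.ne'), map_zero,
        map_zero, add_zero, add_zero, ← Nat.cast_add, hzv, add_comm j i, ← sub_smul, smul_smul]
      congr 1
      split_ifs with h
      · rw [← hrel i j hi1 hj1 h]
        push_cast
        ring
      · rw [ha _ (by omega)]
        simp
  · intro i hi hi'
    obtain ⟨i, rfl⟩ := Int.eq_ofNat_of_zero_le (by omega : 0 ≤ i)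
    rw [offDiag, Finset.sum_eq_single (p - 1)]
    · rw [Nat.sub_self, pow_zero, Module.End.one_apply, hzv, map_smul]
      rcases lt_or_ge d i with h | h
      · rw [ha i h, zero_smul]
      · have : ix p d i = d - i := natCast_inj_of_lt (K := K) (p := p) (ix_lt (by omega) d i)
          (by omega) (by rw [ix_cast (by omega), Nat.cast_sub h])
        rw [this, vermaRho_pow_vv_eq_zero c lam (by omega) (by omega) (by omega), smul_zero]
    · intro k hk hk1
      obtain ⟨m, hm⟩ : ∃ m, p - 1 - k = m + 1 :=
        ⟨p - 1 - k - 1, by have := Finset.mem_range.1 hk; omega⟩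
      rw [hm, pow_succ, Module.End.mul_apply, vermaRho_vv_zero c lam' hp (by omega),
        if_neg (by omega), map_zero, map_zero, map_zero]
    · intro h
      exact absurd (Finset.mem_range.2 (by omega)) h

end Existence

section Relations

variable {K : Type} [Field K]

lemma wc_one (lam x : K) : wc lam 1 x = -(x * (2 * lam - x + 1)) := by
  simp only [wc, Finset.prod_range_succ, Finset.prod_range_zero]
  push_cast
  ring

lemma wc_two (lam x : K) : wc lam 2 x = x * (x - 1) * (3 * lam - x + 2) := by
  simp only [wc, Finset.prod_range_succ, Finset.prod_range_zero]
  push_cast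
  ring

lemma wc_three (lam x : K) : wc lam 3 x = -(x * (x - 1) * (x - 2) * (4 * lam - x + 3)) := by
  simp only [wc, Finset.prod_range_succ, Finset.prod_range_zero]
  push_cast
  ring

lemma wc_four (lam x : K) :
    wc lam 4 x = x * (x - 1) * (x - 2) * (x - 3) * (5 * lam - x + 4) := by
  simp only [wc, Finset.prod_range_succ, Finset.prod_range_zero]
  push_cast
  ring

lemma wc_five (lam x : K) :
    wc lam 5 x = -(x * (x - 1) * (x - 2) * (x - 3) * (x - 4) * (6 * lam - x + 5)) := by
  simp only [wc, Finset.prod_range_succ, Finset.prod_range_zero]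
  push_cast
  ring

lemma wc_six (lam x : K) : wc lam 6 x =
    x * (x - 1) * (x - 2) * (x - 3) * (x - 4) * (x - 5) * (7 * lam - x + 6) := by
  simp only [wc, Finset.prod_range_succ, Finset.prod_range_zero]
  push_cast
  ring

variable {p : ℕ} [CharP K p] {c lam lam' : K} {d : ℕ}
  {z : ℤ → (Fin p → K) →ₗ[K] (Fin p → K)} {a : ℕ → K}

lemma HasData.relation_one_two (h : HasData p c lam lam' d z a) (hp : 4 ≤ p) :
    a 3 = a 2 * wc lam 1 ((d : K) - 2) - a 1 * wc lam 2 ((d : K) - 1) := by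
  have := h.relation (i := 1) (j := 2) (by omega) (by omega) (by omega) (by omega)
  push_cast at this
  linear_combination this

lemma HasData.relation_one_three (h : HasData p c lam lam' d z a) (hp : 5 ≤ p) :
    2 * a 4 = a 3 * wc lam 1 ((d : K) - 3) - a 1 * wc lam 3 ((d : K) - 1) := by
  have := h.relation (i := 1) (j := 3) (by omega) (by omega) (by omega) (by omega)
  push_cast at this
  linear_combination this

lemma HasData.relation_two_three (h : HasData p c lam lam' d z a) (hp : 5 ≤ p) :
    a 5 = a 3 * wc lam 2 ((d : K) - 3) - a 2 * wc lam 3 ((d : K) - 2) := by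
  have := h.relation (i := 2) (j := 3) (by omega) (by omega) (by omega) (by omega)
  push_cast at this
  linear_combination this

lemma HasData.relation_one_four (h : HasData p c lam lam' d z a) (hp : 6 ≤ p) :
    3 * a 5 = a 4 * wc lam 1 ((d : K) - 4) - a 1 * wc lam 4 ((d : K) - 1) := by
  have := h.relation (i := 1) (j := 4) (by omega) (by omega) (by omega) (by omega)
  push_cast at this
  linear_combination this

lemma HasData.relation_two_four (h : HasData p c lam lam' d z a) (hp : 6 ≤ p) :
    2 * a 6 = a 4 * wc lam 2 ((d : K) - 4) - a 2 * wc lam 4 ((d : K) - 2) := by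
  have := h.relation (i := 2) (j := 4) (by omega) (by omega) (by omega) (by omega)
  push_cast at this
  linear_combination this

lemma HasData.relation_one_five (h : HasData p c lam lam' d z a) (hp : 7 ≤ p) :
    4 * a 6 = a 5 * wc lam 1 ((d : K) - 5) - a 1 * wc lam 5 ((d : K) - 1) := by
  have := h.relation (i := 1) (j := 5) (by omega) (by omega) (by omega) (by omega)
  push_cast at this
  linear_combination this

lemma HasData.relation_two_five (h : HasData p c lam lam' d z a) (hp : 7 ≤ p) :
    3 * a 7 = a 5 * wc lam 2 ((d : K) - 5) - a 2 * wc lam 5 ((d : K) - 2) := by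
  have := h.relation (i := 2) (j := 5) (by omega) (by omega) (by omega) (by omega)
  push_cast at this
  linear_combination this

lemma HasData.relation_one_six (h : HasData p c lam lam' d z a) (hp : 8 ≤ p) :
    5 * a 7 = a 6 * wc lam 1 ((d : K) - 6) - a 1 * wc lam 6 ((d : K) - 1) := by
  have := h.relation (i := 1) (j := 6) (by omega) (by omega) (by omega) (by omega)
  push_cast at this
  linear_combination this

/-- The linear form in `(a 1, a 2)` vanishing on coboundaries. -/
def lform (lam D x y : K) : K := (D - 1) * (3 * lam - D + 2) * x + (2 * lam - D + 1) * y

/-- The quadratic polynomial controlling the nontrivial cocycles in degree six. -/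
def qpoly (lam D : K) : K := 4 * lam ^ 2 - 4 * lam * D + 4 * lam + D ^ 2 - 5 * D

lemma HasData.qpoly_mul_lform (h : HasData p c lam lam' d z a) (hp : 7 ≤ p) :
    ((d : K) - 2) * (d - 3) * (d - 4) * qpoly lam d * lform lam d (a 1) (a 2) = 0 := by
  have e12 := h.relation_one_two (by omega)
  have e13 := h.relation_one_three (by omega)
  have e14 := h.relation_one_four (by omega)
  have e23 := h.relation_two_three (by omega)
  rw [wc_one, wc_two] at e12
  rw [wc_one, wc_three] at e13
  rw [wc_one, wc_four] at e14
  rw [wc_two, wc_three] at e23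
  generalize (d : K) = D at *
  rw [lform, qpoly]
  linear_combination (-6) * e23 + 2 * e14 + (-((D - 4) * (2 * lam - (D - 4) + 1))) * e13 +
    (-6 * ((D - 3) * (D - 3 - 1) * (3 * lam - (D - 3) + 2)) +
      (D - 4) * (2 * lam - (D - 4) + 1) * ((D - 3) * (2 * lam - (D - 3) + 1))) * e12

lemma HasData.prod_mul_lform (h : HasData p c lam lam' d z a) (hp : 8 ≤ p)
    (hq : qpoly lam (d : K) = 0) :
    3 * (((d : K) - 2) * (d - 3) * (d - 4) * (d * (d - 1) * (d - 5) * (d - 6)) *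
      lform lam d (a 1) (a 2)) = 0 := by
  have e12 := h.relation_one_two (by omega)
  have e13 := h.relation_one_three (by omega)
  have e14 := h.relation_one_four (by omega)
  have e15 := h.relation_one_five (by omega)
  have e16 := h.relation_one_six (by omega)
  have e25 := h.relation_two_five (by omega)
  rw [wc_one, wc_two] at e12
  rw [wc_one, wc_three] at e13
  rw [wc_one, wc_four] at e14
  rw [wc_one, wc_five] at e15
  rw [wc_one, wc_six] at e16
  rw [wc_two, wc_five] at e25
  generalize (d : K) = D at *
  rw [qpoly] at hq
  rw [lform]
  have w (x : K) : ∃ y, y = -(x * (2 * lam - x + 1)) := ⟨_, rfl⟩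
  obtain ⟨w3, hw3⟩ := w (D - 3)
  obtain ⟨w4, hw4⟩ := w (D - 4)
  obtain ⟨w5, hw5⟩ := w (D - 5)
  obtain ⟨w6, hw6⟩ := w (D - 6)
  obtain ⟨w25, hw25⟩ : ∃ y, y = (D - 5) * (D - 5 - 1) * (3 * lam - (D - 5) + 2) := ⟨_, rfl⟩
  rw [← hw3] at e13
  rw [← hw4] at e14
  rw [← hw5] at e15
  rw [← hw6] at e16
  rw [← hw25] at e25
  have key : 0 = (20 * w25 - 3 * w6 * w5) *
      (w4 * (w3 * (a 2 * -((D - 2) * (2 * lam - (D - 2) + 1)) -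
      a 1 * ((D - 1) * (D - 1 - 1) * (3 * lam - (D - 1) + 2))) + a 1 * ((D - 1) * (D - 1 - 1) *
      (D - 1 - 2) * (4 * lam - (D - 1) + 3))) - 2 * a 1 * ((D - 1) * (D - 1 - 1) * (D - 1 - 2) *
      (D - 1 - 3) * (5 * lam - (D - 1) + 4))) -
      18 * w6 * a 1 * ((D - 1) * (D - 1 - 1) * (D - 1 - 2) * (D - 1 - 3) * (D - 1 - 4) *
        (6 * lam - (D - 1) + 5)) +
      120 * a 2 * ((D - 2) * (D - 2 - 1) * (D - 2 - 2) * (D - 2 - 3) * (D - 2 - 4) *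
        (6 * lam - (D - 2) + 5)) +
      72 * a 1 * ((D - 1) * (D - 1 - 1) * (D - 1 - 2) * (D - 1 - 3) * (D - 1 - 4) * (D - 1 - 5) *
        (7 * lam - (D - 1) + 6)) := by
    linear_combination 120 * e25 - 72 * e16 - 18 * w6 * e15 +
      (20 * w25 - 3 * w6 * w5) * (2 * e14 + w4 * e13 + w4 * w3 * e12)
  subst hw3 hw4 hw5 hw6 hw25
  linear_combination key + ((D - 2) * (D - 3) * (D - 4)) *
    (12 * lam ^ 2 * D ^ 2 - 132 * lam ^ 2 * D + 360 * lam ^ 2 - 12 * lam * D ^ 3 +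
      204 * lam * D ^ 2 - 1152 * lam * D + 2160 * lam + 3 * D ^ 4 - 70 * D ^ 3 + 618 * D ^ 2 -
      2441 * D + 3630) * ((D - 1) * (3 * lam - D + 2) * a 1 + (2 * lam - D + 1) * a 2) * hq

lemma natCast_ne_zero_of_lt {n : ℕ} (h0 : 0 < n) (hn : n < p) : (n : K) ≠ 0 := fun h =>
  h0.ne' (natCast_inj_of_lt (K := K) hn (by omega) (by rw [h, Nat.cast_zero]))

lemma HasData.lform_eq_zero (h : HasData p c lam lam' d z a) (hp : 7 ≤ p) (hd : d < p)
    (hdval : (d : K) = lam - lam') (h0 : lam ≠ 0) (h1 : lam ≠ -1) (h0' : lam' ≠ 0)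
    (h1' : lam' ≠ -1) (hd2 : d ≠ 2) (hd3 : d ≠ 3) (hd4 : d ≠ 4)
    (hd6 : d = 6 → 8 ≤ p ∧ qpoly lam 6 ≠ 0) : lform lam (d : K) (a 1) (a 2) = 0 := by
  by_contra hL
  have hsub : ∀ n : ℕ, n < p → d ≠ n → (d : K) - n ≠ 0 := fun n hn hne h =>
    hne (natCast_inj_of_lt (K := K) hd hn (sub_eq_zero.1 h))
  have h2 : (d : K) - 2 ≠ 0 := by exact_mod_cast hsub 2 (by omega) hd2
  have h3 : (d : K) - 3 ≠ 0 := by exact_mod_cast hsub 3 (by omega) hd3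
  have h4 : (d : K) - 4 ≠ 0 := by exact_mod_cast hsub 4 (by omega) hd4
  have n2 : (2 : K) ≠ 0 := by
    exact_mod_cast natCast_ne_zero_of_lt (K := K) (p := p) (n := 2) (by omega) (by omega)
  have n3 : (3 : K) ≠ 0 := by
    exact_mod_cast natCast_ne_zero_of_lt (K := K) (p := p) (n := 3) (by omega) (by omega)
  have hq : qpoly lam (d : K) = 0 := by
    have := h.qpoly_mul_lform hp
    simpa [h2, h3, h4, hL] using this
  have hq' := hq
  rw [qpoly] at hq
  have hne : ∀ x y : K, x ≠ 0 → y ≠ 0 → 2 * 2 * x * y ≠ 0 := fun x y hx hy =>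
    mul_ne_zero (mul_ne_zero (mul_ne_zero n2 n2) hx) hy
  have hd0 : d ≠ 0 := by
    rintro rfl
    rw [Nat.cast_zero] at hq
    exact hne lam (lam + 1) h0 (fun h => h1 (by linear_combination h)) (by linear_combination hq)
  have hd1 : d ≠ 1 := by
    rintro rfl
    rw [Nat.cast_one] at hq hdval
    exact hne (lam - 1) (lam + 1) (fun h => h0' (by linear_combination h + hdval))
      (fun h => h1 (by linear_combination h)) (by linear_combination hq)
  have hd5 : d ≠ 5 := by
    rintro rfl
    push_cast at hq hdval
    exact hne lam (lam - 4) h0 (fun h => h1' (by linear_combination h + hdval))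
      (by linear_combination hq)
  have hd6' : d ≠ 6 := by
    rintro rfl
    push_cast at hq'
    exact (hd6 rfl).2 hq'
  rcases eq_or_lt_of_le hp with rfl | hp8
  · omega
  · have h6 : (d : K) - 6 ≠ 0 := by exact_mod_cast hsub 6 (by omega) hd6'
    have h5 : (d : K) - 5 ≠ 0 := by exact_mod_cast hsub 5 (by omega) hd5
    have h1d : (d : K) - 1 ≠ 0 := by exact_mod_cast hsub 1 (by omega) hd1
    have h0d : (d : K) ≠ 0 := natCast_ne_zero_of_lt (p := p) (by omega) hd
    have := h.prod_mul_lform hp8 hq'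
    simp only [mul_eq_zero] at this
    tauto

end Relations

section Proportionality

variable {K : Type} [Field K] {p : ℕ} [CharP K p] {c lam lam' : K} {d : ℕ}
  {z : ℤ → (Fin p → K) →ₗ[K] (Fin p → K)} {a : ℕ → K}

lemma exists_eq_mul_of_mul_eq {x y u v : K} (huv : u ≠ 0 ∨ v ≠ 0) (h : u * y = v * x) :
    ∃ t, x = t * u ∧ y = t * v := by
  rcases huv with hu | hv
  · refine ⟨x / u, by field_simp, ?_⟩
    field_simp
    linear_combination h
  · refine ⟨y / v, ?_, by field_simp⟩
    field_simp
    linear_combination -h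

lemma wc_one_ne_zero_or (hp : 3 < p) (hd : d < p) (hd0 : d ≠ 0) (h0 : lam ≠ 0) (h1 : lam ≠ -1) :
    wc lam 1 (d : K) ≠ 0 ∨ wc lam 2 (d : K) ≠ 0 := by
  by_contra hcon
  push Not at hcon
  obtain ⟨hu, hv⟩ := hcon
  have hD : (d : K) ≠ 0 := natCast_ne_zero_of_lt (p := p) (by omega) hd
  have n2 : (2 : K) ≠ 0 := by
    exact_mod_cast natCast_ne_zero_of_lt (K := K) (p := p) (n := 2) (by omega) (by omega)
  rw [wc_one, neg_eq_zero] at hu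
  rw [wc_two, mul_assoc] at hv
  have hu' := (mul_eq_zero.1 hu).resolve_left hD
  rcases mul_eq_zero.1 ((mul_eq_zero.1 hv).resolve_left hD) with h | h
  · exact h0 ((mul_eq_zero.1 (by linear_combination hu' + h : 2 * lam = 0)).resolve_left n2)
  · exact h1 (by linear_combination h - hu')

lemma HasData.one_eq_zero_of_lform [Fact p.Prime] (h : HasData p c lam lam' 0 z a) (hp : 3 < p)
    (h1 : lam ≠ -1) (hL : lform lam 0 (a 1) (a 2) = 0) : a 1 = 0 ∧ a 2 = 0 := by
  rw [lform] at hL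
  have huv : 2 * lam + 1 ≠ 0 ∨ 3 * lam + 2 ≠ 0 := by
    by_contra hcon
    push Not at hcon
    exact h1 (by linear_combination hcon.2 - hcon.1)
  obtain ⟨t, ht1, ht2⟩ := exists_eq_mul_of_mul_eq (x := a 1) (y := a 2) huv
    (by linear_combination hL)
  have hwc : ∀ j : ℕ, wc lam j (-1) = (j.factorial : K) * ((j + 1) * (lam + 1)) := by
    intro j
    have : ∏ s ∈ Finset.range j, ((-1 : K) - s) = (-1) ^ j * (j.factorial : K) := by
      induction j with
      | zero => simp
      | succ j ih =>
        rw [Finset.prod_range_succ, ih, Nat.factorial_succ]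
        push_cast
        ring
    rw [wc, this, ← mul_assoc, ← pow_add, ← two_mul, pow_mul]
    ring
  have hrel : ∀ j : ℕ, 1 ≤ j → j + 2 ≤ p → ((j : K) - 1) * a (j + 1) =
      a j * (j * (2 * lam + j + 1)) - a 1 * ((j.factorial : K) * ((j + 1) * (lam + 1))) := by
    intro j hj hj'
    have := h.relation (i := 1) (j := j) le_rfl (by omega) hj hj'
    rw [Nat.cast_zero, Nat.cast_one, zero_sub, zero_sub, wc_one, hwc, add_comm 1 j] at this
    linear_combination this
  have hform : ∀ j : ℕ, j + 3 ≤ p → a (j + 1) = t * (j.factorial * ((j + 2) * lam + (j + 1))) := by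
    intro j
    induction j with
    | zero => intro _; rw [ht1]; simp
    | succ j ih =>
      intro hj
      rcases Nat.eq_zero_or_pos j with rfl | hj0
      · rw [ht2]
        norm_num
      · have hr := hrel (j + 1) (by omega) (by omega)
        have hj1 : (j : K) ≠ 0 := natCast_ne_zero_of_lt (p := p) hj0 (by omega)
        rw [ih (by omega), ht1, Nat.factorial_succ] at hr
        rw [Nat.factorial_succ]
        push_cast at hr ⊢
        refine mul_left_cancel₀ hj1 ?_
        linear_combination hr
  have hlast := hrel (p - 2) (by omega) (by omega)
  have hf := hform (p - 3) (by omega)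
  rw [h.large (p - 2 + 1) (by omega), ht1] at hlast
  rw [show p - 3 + 1 = p - 2 by omega] at hf
  rw [hf, show p - 2 = p - 3 + 1 by omega, Nat.factorial_succ] at hlast
  have hp3 : ((p - 3 : ℕ) : K) = -3 := by
    rw [Nat.cast_sub (by omega), CharP.cast_eq_zero K p]; push_cast; ring
  push_cast at hlast
  rw [hp3] at hlast
  have hfac : ((p - 3).factorial : K) ≠ 0 := by
    rw [Ne, CharP.cast_eq_zero_iff K p, (Fact.out : p.Prime).dvd_factorial]
    omega
  have n2 : (2 : K) ≠ 0 := by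
    exact_mod_cast natCast_ne_zero_of_lt (K := K) (p := p) (n := 2) (by omega) (by omega)
  have n3 : (3 : K) ≠ 0 := by
    exact_mod_cast natCast_ne_zero_of_lt (K := K) (p := p) (n := 3) (by omega) (by omega)
  have ht : t = 0 := by
    have : 2 * 3 * ((p - 3).factorial : K) * t = 0 := by linear_combination hlast
    exact (mul_eq_zero.1 this).resolve_left (mul_ne_zero (mul_ne_zero n2 n3) hfac)
  rw [ht1, ht2, ht]
  simp

lemma HasData.mul_eq_of_seven {z : ℤ → (Fin 7 → K) →ₗ[K] (Fin 7 → K)} [CharP K 7]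
    (h : HasData 7 c lam lam' 6 z a) (h0 : lam ≠ 0) :
    wc lam 1 ((6 : ℕ) : K) * a 2 = wc lam 2 ((6 : ℕ) : K) * a 1 := by
  have h7 : (7 : K) = 0 := by exact_mod_cast CharP.cast_eq_zero K 7
  have e12 := h.relation_one_two (by omega)
  have e13 := h.relation_one_three (by omega)
  have e14 := h.relation_one_four (by omega)
  have e15 := h.relation_one_five (by omega)
  have e24 := h.relation_two_four (by omega)
  have h6 := h.large 6 (by omega)
  rw [wc_one, wc_two] at e12
  rw [wc_one, wc_three] at e13
  rw [wc_one, wc_four] at e14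
  rw [wc_one, wc_five] at e15
  rw [wc_two, wc_four] at e24
  push_cast at e12 e13 e14 e15 e24
  have key : lam * (4 * a 1 + a 2) = 0 := by
    linear_combination (-(3 + 2 * lam)) * (6 * e15 - 24 * h6 +
      2 * (-((6 - 5) * (2 * lam - (6 - 5) + 1))) * e14 +
      (6 - 5) * (2 * lam - (6 - 5) + 1) * ((6 - 4) * (2 * lam - (6 - 4) + 1)) *
        (e13 + (-((6 - 3) * (2 * lam - (6 - 3) + 1))) * e12)) -
      (6 + 2 * lam + 2 * lam ^ 2) * (2 * e24 - 4 * h6 +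
        (6 - 4) * (6 - 4 - 1) * (3 * lam - (6 - 4) + 2) * (e13 +
          (-((6 - 3) * (2 * lam - (6 - 3) + 1))) * e12)) -
      ((2468 * lam + 1440 * lam ^ 2 + 960 * lam ^ 3 - 480 * lam ^ 4 + 1440 * lam ^ 5) * a 1 +
        (41 * lam - 192 * lam ^ 2 - 96 * lam ^ 3 - 288 * lam ^ 4 + 192 * lam ^ 5) * a 2) * h7
  have key' := (mul_eq_zero.1 key).resolve_left h0
  rw [wc_one, wc_two]
  push_cast
  linear_combination (-12 * lam + 30) * key' + (-6 * lam) * a 1 * h7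

variable {z5 : ℤ → (Fin 5 → K) →ₗ[K] (Fin 5 → K)} [CharP K 5]

lemma HasData.one_eq_zero_of_five_zero (h : HasData 5 c lam lam' 0 z5 a) (h0 : lam ≠ 0)
    (h1 : lam ≠ -1) :
    a 1 = 0 ∧ a 2 = 0 := by
  have h5 : (5 : K) = 0 := by exact_mod_cast CharP.cast_eq_zero K 5
  have e12 := h.relation_one_two (by omega)
  have e13 := h.relation_one_three (by omega)
  have e23 := h.relation_two_three (by omega)
  rw [wc_one, wc_two] at e12
  rw [wc_one, wc_three] at e13
  rw [wc_two, wc_three] at e23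
  rw [h.large 4 (by omega)] at e13
  rw [h.large 5 (by omega)] at e23
  rw [e12] at e13 e23
  rw [Nat.cast_zero] at e13 e23
  have hg : lam * ((lam + 1) * a 1 + lam * a 2) = 0 := by
    linear_combination e23 + (lam * ((lam + 1) * a 1 + lam * a 2) +
      (-72 - 116 * lam - 44 * lam ^ 2) * a 1 + (48 + 72 * lam + 28 * lam ^ 2) * a 2) * h5
  have hg' := (mul_eq_zero.1 hg).resolve_left h0
  have ha2 : a 2 = 0 := by
    linear_combination -3 * e13 - 12 * (lam + 1) * hg' -
      (3 * ((-20 - 28 * lam - 8 * lam ^ 2) * a 1 +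
      (14 + 16 * lam + 4 * lam ^ 2) * a 2) + a 2) * h5
  rw [ha2, mul_zero, add_zero] at hg'
  exact ⟨(mul_eq_zero.1 hg').resolve_left fun h => h1 (by linear_combination h), ha2⟩

lemma HasData.mul_eq_of_five_one (h : HasData 5 c lam lam' 1 z5 a) (h1 : lam ≠ 1)
    (h2 : lam ≠ -1) : wc lam 1 ((1 : ℕ) : K) * a 2 = wc lam 2 ((1 : ℕ) : K) * a 1 := by
  have h5 : (5 : K) = 0 := by exact_mod_cast CharP.cast_eq_zero K 5
  have e12 := h.relation_one_two (by omega)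
  have e13 := h.relation_one_three (by omega)
  rw [wc_one, wc_two] at e12
  rw [wc_one, wc_three] at e13
  rw [h.large 4 (by omega), e12] at e13
  rw [Nat.cast_one] at e13
  have key : (lam + 1) * (lam - 1) * a 2 = 0 := by
    linear_combination -2 * e13 - (3 * lam ^ 2 + 8 * lam + 5) * a 2 * h5
  have ha2 : a 2 = 0 := (mul_eq_zero.1 key).resolve_left
    (mul_ne_zero (fun h => h2 (by linear_combination h)) (sub_ne_zero.2 h1))
  rw [ha2, wc_two, Nat.cast_one]
  ring

lemma HasData.mul_eq_of_five_four (h : HasData 5 c lam lam' 4 z5 a) (h0 : lam ≠ 0)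
    (h3 : lam ≠ 3) : wc lam 1 ((4 : ℕ) : K) * a 2 = wc lam 2 ((4 : ℕ) : K) * a 1 := by
  have h5 : (5 : K) = 0 := by exact_mod_cast CharP.cast_eq_zero K 5
  have e12 := h.relation_one_two (by omega)
  have e13 := h.relation_one_three (by omega)
  rw [wc_one, wc_two] at e12
  rw [wc_one, wc_three] at e13
  rw [h.large 4 (by omega), e12] at e13
  push_cast at e13
  have key : lam * (lam - 3) * (2 * a 1 + a 2) = 0 := by
    linear_combination -2 * e13 - ((6 * lam + 14 * lam ^ 2) * a 1 + (3 * lam ^ 2 - lam) * a 2) * h5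
  have key' := (mul_eq_zero.1 key).resolve_left (mul_ne_zero h0 (sub_ne_zero.2 h3))
  rw [wc_one, wc_two]
  push_cast
  linear_combination (12 - 8 * lam) * key' - 4 * lam * a 1 * h5

end Proportionality

section Classification

variable {K : Type} [Field K] {p : ℕ} [CharP K p] {c lam lam' : K} {d : ℕ}
  {z : ℤ → (Fin p → K) →ₗ[K] (Fin p → K)} {a : ℕ → K}

/-- The degrees `d = [λ - λ']` in which there is a nontrivial extension. -/
def IsExceptional (p d : ℕ) (lam : K) : Prop :=
  (d = 2 ∨ d = 3) ∨ (d = 4 ∧ p ≠ 5) ∨ (d = 6 ∧ 7 < p ∧ qpoly lam 6 = 0)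

lemma HasData.exists_coord_pair [Fact p.Prime] (h : HasData p c lam lam' d z a) (hp : 3 < p)
    (hd : d < p) (hdval : (d : K) = lam - lam') (h0 : lam ≠ 0) (h1 : lam ≠ -1) (h0' : lam' ≠ 0)
    (h1' : lam' ≠ -1) (hE : ¬ IsExceptional p d lam) :
    ∃ t : K, a 1 = t * wc lam 1 d ∧ a 2 = t * wc lam 2 d := by
  have hprime : p.Prime := Fact.out
  have hp4 : p ≠ 4 := by rintro rfl; exact absurd hprime (by norm_num)
  have hp6 : p ≠ 6 := by rintro rfl; exact absurd hprime (by norm_num)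
  simp only [IsExceptional, not_or, not_and, not_not] at hE
  obtain ⟨⟨hd2, hd3⟩, hd4, hd6⟩ := hE
  have hzero : a 1 = 0 ∧ a 2 = 0 → ∃ t : K, a 1 = t * wc lam 1 d ∧ a 2 = t * wc lam 2 d :=
    fun h => ⟨0, by rw [h.1, zero_mul], by rw [h.2, zero_mul]⟩
  have hmul : d ≠ 0 → wc lam 1 (d : K) * a 2 = wc lam 2 (d : K) * a 1 →
      ∃ t : K, a 1 = t * wc lam 1 d ∧ a 2 = t * wc lam 2 d :=
    fun hd0 h => exists_eq_mul_of_mul_eq (wc_one_ne_zero_or hp hd hd0 h0 h1) h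
  rcases eq_or_ne p 5 with rfl | hp5
  · obtain rfl | rfl | rfl : d = 0 ∨ d = 1 ∨ d = 4 := by omega
    · exact hzero (h.one_eq_zero_of_five_zero h0 h1)
    · refine hmul one_ne_zero (h.mul_eq_of_five_one (fun h => h0' ?_) h1)
      push_cast at hdval
      linear_combination h + hdval
    · refine hmul four_ne_zero (h.mul_eq_of_five_four h0 fun h => h1' ?_)
      push_cast at hdval
      linear_combination h + hdval
  · by_cases h76 : p = 7 ∧ d = 6
    · obtain ⟨rfl, rfl⟩ := h76
      exact hmul (by omega) (h.mul_eq_of_seven h0)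
    · have hL := h.lform_eq_zero (by omega) hd hdval h0 h1 h0' h1' hd2 hd3
        (fun h => hp5 (hd4 h)) (fun h => ⟨by omega, hd6 h (by omega)⟩)
      rcases eq_or_ne d 0 with rfl | hd0
      · rw [Nat.cast_zero] at hL
        exact hzero (h.one_eq_zero_of_lform hp h1 hL)
      · refine hmul hd0 ?_
        rw [lform] at hL
        rw [wc_one, wc_two]
        linear_combination (-(d : K)) * hL

lemma exists_hasData_of_relation_lt [Fact p.Prime] (hd : d + 2 ≤ p)
    (hdval : (d : K) = lam - lam') (ha0 : a 0 = 0) (ha : ∀ j, d < j → a j = 0)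
    (hrel : ∀ i j, 1 ≤ i → i < j → i + j ≤ d → ((j : K) - i) * a (i + j) =
      a j * wc lam i ((d : K) - j) - a i * wc lam j ((d : K) - i)) :
    ∃ z, HasData p c lam lam' d z a := by
  refine exists_hasData_of_relation hd hdval ha0 ha fun i j hi hj hij => ?_
  rcases lt_trichotomy i j with h | rfl | h
  · exact hrel i j hi h hij
  · ring
  · have := hrel j i hj h (by omega)
    rw [add_comm j i] at this
    linear_combination -this

/-- The sequence with the given terms in positions one to six. -/
def seqSix (x y a3 a4 a5 a6 : K) : ℕ → K
  | 1 => x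
  | 2 => y
  | 3 => a3
  | 4 => a4
  | 5 => a5
  | 6 => a6
  | _ => 0

lemma exists_hasData_pair [Fact p.Prime] (hp : 3 < p) (hd : d < p)
    (hdval : (d : K) = lam - lam') (hE : IsExceptional p d lam) (x y : K) :
    ∃ z a, HasData p c lam lam' d z a ∧ a 1 = x ∧ a 2 = y := by
  have hprime : p.Prime := Fact.out
  have hp4 : p ≠ 4 := by rintro rfl; exact absurd hprime (by norm_num)
  have hp6 : p ≠ 6 := by rintro rfl; exact absurd hprime (by norm_num)
  have n2 : (2 : K) ≠ 0 := by
    exact_mod_cast natCast_ne_zero_of_lt (K := K) (p := p) (n := 2) (by omega) (by omega)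
  have n3 : (3 : K) ≠ 0 := by
    exact_mod_cast natCast_ne_zero_of_lt (K := K) (p := p) (n := 3) (by omega) (by omega)
  obtain ⟨a3, h3⟩ : ∃ t, t = y * wc lam 1 ((d : K) - 2) - x * wc lam 2 ((d : K) - 1) := ⟨_, rfl⟩
  obtain ⟨a4, h4⟩ : ∃ t, 2 * t = a3 * wc lam 1 ((d : K) - 3) - x * wc lam 3 ((d : K) - 1) :=
    ⟨_, mul_div_cancel₀ _ n2⟩
  rcases hE with (rfl | rfl) | ⟨rfl, hp5⟩ | ⟨rfl, hp7, hq⟩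
  · obtain ⟨z, hz⟩ := exists_hasData_of_relation_lt (c := c) (a := seqSix x y 0 0 0 0)
      (by omega) hdval rfl
      (fun j hj => by rcases j with _ | _ | _ | _ | _ | _ | _ | _ <;> first | rfl | omega)
      (fun i j hi hij hijd => by omega)
    exact ⟨z, _, hz, rfl, rfl⟩
  · obtain ⟨z, hz⟩ := exists_hasData_of_relation_lt (c := c) (a := seqSix x y a3 0 0 0)
      (by omega) hdval rfl
      (fun j hj => by rcases j with _ | _ | _ | _ | _ | _ | _ | _ <;> first | rfl | omega)
      (fun i j hi hij hijd => by
        obtain ⟨rfl, rfl⟩ : i = 1 ∧ j = 2 := by omega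
        simp only [seqSix]
        push_cast at h3 ⊢
        linear_combination h3)
    exact ⟨z, _, hz, rfl, rfl⟩
  · obtain ⟨z, hz⟩ := exists_hasData_of_relation_lt (c := c) (a := seqSix x y a3 a4 0 0)
      (by omega) hdval rfl
      (fun j hj => by rcases j with _ | _ | _ | _ | _ | _ | _ | _ <;> first | rfl | omega)
      (fun i j hi hij hijd => by
        obtain ⟨rfl, rfl⟩ | ⟨rfl, rfl⟩ : i = 1 ∧ j = 2 ∨ i = 1 ∧ j = 3 := by omega
        all_goals
          simp only [seqSix]
          push_cast at h3 h4 ⊢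
        · linear_combination h3
        · linear_combination h4)
    exact ⟨z, _, hz, rfl, rfl⟩
  · have hp8 : p ≠ 8 := by rintro rfl; exact absurd hprime (by norm_num)
    obtain ⟨a5, h5⟩ : ∃ t, 3 * t = a4 * wc lam 1 (((6 : ℕ) : K) - 4) -
      x * wc lam 4 (((6 : ℕ) : K) - 1) := ⟨_, mul_div_cancel₀ _ n3⟩
    obtain ⟨a6, h6⟩ : ∃ t, 2 * 2 * t = a5 * wc lam 1 (((6 : ℕ) : K) - 5) -
      x * wc lam 5 (((6 : ℕ) : K) - 1) := ⟨_, mul_div_cancel₀ _ (mul_ne_zero n2 n2)⟩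
    have n6 : (2 * 3 : K) ≠ 0 := mul_ne_zero n2 n3
    have n12 : (2 * 2 * 3 : K) ≠ 0 := mul_ne_zero (mul_ne_zero n2 n2) n3
    obtain ⟨z, hz⟩ := exists_hasData_of_relation_lt (c := c) (a := seqSix x y a3 a4 a5 a6)
      (by omega) hdval rfl
      (fun j hj => by rcases j with _ | _ | _ | _ | _ | _ | _ | _ <;> first | rfl | omega)
      (fun i j hi hij hijd => by
        push_cast at h3 h4 h5 h6
        have hcase : i = 1 ∧ j = 2 ∨ i = 1 ∧ j = 3 ∨ i = 1 ∧ j = 4 ∨ i = 1 ∧ j = 5 ∨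
          i = 2 ∧ j = 3 ∨ i = 2 ∧ j = 4 := by omega
        rcases hcase with ⟨rfl, rfl⟩ | ⟨rfl, rfl⟩ | ⟨rfl, rfl⟩ | ⟨rfl, rfl⟩ | ⟨rfl, rfl⟩ |
          ⟨rfl, rfl⟩
        all_goals
          simp only [seqSix]
          push_cast
        · linear_combination h3
        · linear_combination h4
        · linear_combination h5
        · linear_combination h6
        · rw [wc_one, wc_two] at h3
          rw [wc_one, wc_three] at h4
          rw [wc_one, wc_four] at h5
          rw [qpoly] at hq
          rw [wc_two, wc_three]
          refine mul_left_cancel₀ n6 ?_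
          linear_combination 2 * h5 - 2 * (2 * lam - 1) * h4 +
            (12 * (2 * lam - 1) * (lam - 1) - 36 * (3 * lam - 1)) * h3 +
            ((480 - 360 * lam) * x + (120 - 48 * lam) * y) * hq
        · rw [wc_one, wc_two] at h3
          rw [wc_one, wc_three] at h4
          rw [wc_one, wc_four] at h5
          rw [wc_one, wc_five] at h6
          rw [qpoly] at hq
          rw [wc_two, wc_four]
          refine mul_left_cancel₀ n12 ?_
          linear_combination 6 * h6 - 4 * lam * h5 + (4 * lam * (2 * lam - 1) - 36 * lam) * h4 -
            (4 * lam * (2 * lam - 1) - 36 * lam) * (6 * (lam - 1)) * h3 -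
            2 * lam * ((480 - 360 * lam) * x + (120 - 48 * lam) * y) * hq)
    exact ⟨z, _, hz, rfl, rfl⟩

end Classification

section Dimension

variable {K : Type} [Field K] {p : ℕ} [CharP K p] [Fact p.Prime] {c lam lam' : K} {d : ℕ}

/-- Up to coboundaries, a cocycle is determined by its coordinates `a 1` and `a 2`, which are
defined modulo those of the basic coboundary. -/
lemma exists_hasData_sub_mem_coboundaries (hd : d < p) (hdval : (d : K) = lam - lam')
    (hl : lam ^ p - lam = lam' ^ p - lam') {z : ℤ → (Fin p → K) →ₗ[K] (Fin p → K)}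
    (hz : z ∈ cocycles K p (-1) (vermaRho K p c lam) (vermaRho K p c lam')) :
    ∃ z' a, HasData p c lam lam' d z' a ∧
      z - z' ∈ coboundaries K p (-1) (vermaRho K p c lam) (vermaRho K p c lam') := by
  obtain ⟨f, a, h⟩ := exists_hasData hd hdval hl hz
  exact ⟨_, a, h, mem_coboundaries_iff.2 ⟨f, (sub_sub_cancel _ _).symm⟩⟩

lemma HasData.mem_coboundaries {z : ℤ → (Fin p → K) →ₗ[K] (Fin p → K)} {a : ℕ → K}
    (h : HasData p c lam lam' d z a) (hp : 3 < p) (hd : d < p) (hdval : (d : K) = lam - lam')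
    (hl : lam ^ p - lam = lam' ^ p - lam') {t : K} (h1 : a 1 = t * wc lam 1 d)
    (h2 : a 2 = t * wc lam 2 d) :
    z ∈ coboundaries K p (-1) (vermaRho K p c lam) (vermaRho K p c lam') := by
  have hz := (h.sub_smul (hasData_cobd hd hdval hl) t).eq_zero
    (by simp [h1, show 3 ≤ p by omega]) (by simp [h2, show 4 ≤ p by omega])
  rw [sub_eq_zero.1 hz]
  exact Submodule.smul_mem _ _ (mem_coboundaries_iff.2 ⟨_, rfl⟩)

lemma finrank_extSpace_of_not_isExceptional (hp : 3 < p) (hd : d < p)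
    (hdval : (d : K) = lam - lam') (hl : lam ^ p - lam = lam' ^ p - lam') (h0 : lam ≠ 0)
    (h1 : lam ≠ -1) (h0' : lam' ≠ 0) (h1' : lam' ≠ -1) (hE : ¬ IsExceptional p d lam) :
    Module.finrank K (extSpace K p (-1) (vermaRho K p c lam) (vermaRho K p c lam')) = 0 := by
  have : Subsingleton (extSpace K p (-1) (vermaRho K p c lam) (vermaRho K p c lam')) := by
    refine Submodule.Quotient.subsingleton_iff.2 (eq_top_iff.2 ?_)
    rintro ⟨z, hz⟩ -
    obtain ⟨z', a, h, hzz'⟩ := exists_hasData_sub_mem_coboundaries hd hdval hl hz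
    obtain ⟨t, ht1, ht2⟩ := h.exists_coord_pair hp hd hdval h0 h1 h0' h1' hE
    have := Submodule.add_mem _ hzz' (h.mem_coboundaries hp hd hdval hl ht1 ht2)
    rwa [sub_add_cancel] at this
  exact Module.finrank_zero_of_subsingleton

lemma finrank_extSpace_of_isExceptional (hp : 3 < p) (hd : d < p)
    (hdval : (d : K) = lam - lam') (hl : lam ^ p - lam = lam' ^ p - lam') (h0 : lam ≠ 0)
    (h1 : lam ≠ -1) (hE : IsExceptional p d lam) :
    Module.finrank K (extSpace K p (-1) (vermaRho K p c lam) (vermaRho K p c lam')) = 1 := by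
  have hd0 : d ≠ 0 := by rintro rfl; simp [IsExceptional] at hE
  have huv := wc_one_ne_zero_or hp hd hd0 h0 h1
  obtain ⟨x, y, hxy⟩ : ∃ x y : K, wc lam 1 (d : K) * y - wc lam 2 (d : K) * x ≠ 0 := by
    rcases huv with h | h
    · exact ⟨0, 1, by simpa using h⟩
    · exact ⟨1, 0, by simpa using h⟩
  obtain ⟨z₀, a₀, hz₀, ha1, ha2⟩ := exists_hasData_pair (c := c) hp hd hdval hE x y
  refine finrank_eq_one (Submodule.Quotient.mk ⟨z₀, hz₀.mem⟩) (fun h => ?_) fun w => ?_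
  · rw [Submodule.Quotient.mk_eq_zero, Submodule.mem_comap] at h
    obtain ⟨f, hf⟩ := mem_coboundaries_iff.1 h
    obtain ⟨t, ht1, ht2⟩ := coord_pair_of_cobd hd hdval hp hz₀ hf
    rw [ha1] at ht1
    rw [ha2] at ht2
    exact hxy (by rw [ht1, ht2]; ring)
  · obtain ⟨⟨z, hz⟩, rfl⟩ := Submodule.Quotient.mk_surjective _ w
    obtain ⟨z', a, h, hzz'⟩ := exists_hasData_sub_mem_coboundaries hd hdval hl hz
    obtain ⟨s, hs⟩ : ∃ s, s * (wc lam 1 (d : K) * y - wc lam 2 (d : K) * x) =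
      wc lam 1 (d : K) * a 2 - wc lam 2 (d : K) * a 1 := ⟨_, div_mul_cancel₀ _ hxy⟩
    obtain ⟨t, ht1, ht2⟩ := exists_eq_mul_of_mul_eq (x := a 1 - s * x) (y := a 2 - s * y) huv
      (by linear_combination -hs)
    have hmem := (h.sub_smul hz₀ s).mem_coboundaries hp hd hdval hl (t := t)
      (by simp [ha1, ht1]) (by simp [ha2, ht2])
    refine ⟨s, ?_⟩
    rw [← Submodule.Quotient.mk_smul, eq_comm, Submodule.Quotient.eq, Submodule.mem_comap]
    have := Submodule.add_mem _ hzz' hmem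
    rwa [sub_add_sub_cancel] at this

end Dimension

section Root

variable {K : Type} [Field K]

lemma exists_sq_eq_nineteen_iff (lam : K) :
    (∃ s : K, s ^ 2 = 19 ∧ (2 * lam = 5 + s ∨ 2 * lam = 5 - s)) ↔ qpoly lam 6 = 0 := by
  rw [qpoly]
  constructor
  · rintro ⟨s, hs, h | h⟩
    · linear_combination hs + (2 * lam - 5 + s) * h
    · linear_combination hs + (2 * lam - 5 - s) * h
  · exact fun h => ⟨2 * lam - 5, by linear_combination h, Or.inl (by ring)⟩

end Root

end WittExt

open scoped Classical in
/-- If `χ` has height `-1`, `0` or `1`, `λ, λ' ∈ Λ(χ)` and `λ, λ' ∉ {0, p-1}`, then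
`Ext(V_χ(λ'), V_χ(λ)) ≅ K` if `[λ-λ'] ∈ {2,3}`, or `[λ-λ'] = 4` and `p ≠ 5`, or
`[λ-λ'] = 6`, `p > 7` and `2λ = 5 ± √19`; and `Ext(V_χ(λ'), V_χ(λ)) = 0` otherwise.
Here `d = [λ-λ']` is the representative in `{0, ..., p-1}` of `λ - λ' ∈ F_p`. -/
theorem ext_verma_verma_generic
    (K : Type) [Field K] [IsAlgClosed K] (p : ℕ) [CharP K p] (hp : 3 < p)
    (chi : ℤ → K) (hsupp : ∀ k : ℤ, (k < -1 ∨ (p : ℤ) - 2 < k) → chi k = 0)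
    (hheight : ∀ k : ℤ, 1 ≤ k → chi k = 0)
    (lam lam' : K)
    (hlam : lam ^ p - lam = chi 0 ^ p) (hlam' : lam' ^ p - lam' = chi 0 ^ p)
    (hl1 : lam ≠ 0) (hl2 : lam ≠ (p : K) - 1) (hl1' : lam' ≠ 0) (hl2' : lam' ≠ (p : K) - 1)
    (d : ℕ) (hd : d < p) (hdval : (d : K) = lam - lam') :
    Module.finrank K (extSpace K p (-1)
        (vermaRho K p (chi (-1) ^ p) lam) (vermaRho K p (chi (-1) ^ p) lam'))
      = if (d = 2 ∨ d = 3) ∨ (d = 4 ∧ p ≠ 5) ∨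
            (d = 6 ∧ 7 < p ∧ ∃ s : K, s ^ 2 = 19 ∧ (2 * lam = 5 + s ∨ 2 * lam = 5 - s))
        then 1 else 0 := by
  have hp0 : p ≠ 0 := by omega
  have : Fact p.Prime := ⟨(CharP.char_is_prime_or_zero K p).resolve_right hp0⟩
  have hcast : (p : K) - 1 = -1 := by rw [CharP.cast_eq_zero, zero_sub]
  rw [hcast] at hl2 hl2'
  have hl : lam ^ p - lam = lam' ^ p - lam' := hlam.trans hlam'.symm
  simp only [WittExt.exists_sq_eq_nineteen_iff]
  split_ifs with hE
  · exact WittExt.finrank_extSpace_of_isExceptional hp hd hdval hl hl1 hl2 hE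
  · exact WittExt.finrank_extSpace_of_not_isExceptional hp hd hdval hl hl1 hl2 hl1' hl2' hE
end

section
/- Let χ be a linear functional on W of height -1, 0 or 1 and let λ ∈ Λ(χ). Then Ext(K_λ, V_χ(λ)), taken in the category of W_0-modules with p-character χ (with V_χ(λ) regarded as a W_0-module by restriction), is isomorphic to K if λ ∈ {0, p-1}, and is 0 otherwise. -/
/-!
Common setup: the Witt algebra `W` over `K` (char `p > 3`) has basis
`e_{-1}, e_0, ..., e_{p-2}` with `[e_i, e_j] = (j-i) e_{i+j}` (and `e_k = 0`
outside the range), and `p`-mapping `e_i^{[p]} = δ_{i0} e_i`.  A module with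
`p`-character `χ` over `W` (resp. the subalgebra `W_0 = <e_0, ..., e_{p-2}>`)
is given by a family of endomorphisms `ρ k` (`k : ℤ`, vanishing outside
`[lo, p-2]` where `lo = -1` for `W` and `lo = 0` for `W_0`) satisfying the
bracket relations and `(ρ i)^p - δ_{i0} ρ i = χ(e_i)^p • 1`.

The Baer Ext space `Ext(N, M)` of two such modules, in the category of
modules with `p`-character `χ`, is realized concretely: an extension
`0 → M → E → N → 0` admits a linear splitting `E ≃ M ⊕ N`, under which the
action of `e_k` is `(m, n) ↦ (ρM k m + c k n, ρN k n)` for a "cocycle"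
`c : ℤ → (N →ₗ M)`; the conditions for `E` to be a module with `p`-character
`χ` are the cocycle conditions below, Baer equivalence corresponds to
differing by a coboundary, and the Baer sum / scalar action correspond to the
linear structure on cocycles.  So `Ext(N, M) ≅ cocycles / coboundaries`.
-/

set_option maxHeartbeats 1000000
set_option synthInstance.maxHeartbeats 1000000

/-- Coordinates of a vector in `K^p`, extended by zero to all natural indices. -/
def zeroExt {K : Type} [Field K] {p : ℕ} (x : Fin p → K) (n : ℕ) : K :=
  if h : n < p then x ⟨n, h⟩ else 0

/-- The weight of `e_j` on `K_λ`. -/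
def oneDimWeight {K : Type} [Field K] (lam : K) (j : ℕ) : K := if j = 0 then lam else 0

section Coordinates

variable {K : Type} [Field K] {p : ℕ}

theorem zeroExt_fin (x : Fin p → K) (k : Fin p) : zeroExt x k = x k := by
  simp [zeroExt]

theorem zeroExt_of_le (x : Fin p → K) {n : ℕ} (h : p ≤ n) : zeroExt x n = 0 := by
  simp [zeroExt, h]

theorem zeroExt_add (x y : Fin p → K) (n : ℕ) :
    zeroExt (x + y) n = zeroExt x n + zeroExt y n := by
  unfold zeroExt; split <;> simp

theorem zeroExt_smul (a : K) (x : Fin p → K) (n : ℕ) :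
    zeroExt (a • x) n = a * zeroExt x n := by
  unfold zeroExt; split <;> simp

theorem zeroExt_sub (x y : Fin p → K) (n : ℕ) :
    zeroExt (x - y) n = zeroExt x n - zeroExt y n := by
  unfold zeroExt; split <;> simp

theorem zeroExt_zero (n : ℕ) : zeroExt (0 : Fin p → K) n = 0 := by
  unfold zeroExt; split <;> simp

theorem zeroExt_sum {ι : Type} (s : Finset ι) (x : ι → Fin p → K) (n : ℕ) :
    zeroExt (∑ i ∈ s, x i) n = ∑ i ∈ s, zeroExt (x i) n := by
  unfold zeroExt; split <;> simp

theorem zeroExt_inj {x y : Fin p → K} : x = y ↔ ∀ n < p, zeroExt x n = zeroExt y n := by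
  refine ⟨fun h n _ => by rw [h], fun h => funext fun k => ?_⟩
  simpa only [zeroExt_fin] using h k k.2

theorem zeroExt_vermaRho (s lam : K) {j : ℕ} (hj : j + 2 ≤ p) (x : Fin p → K) (k : ℕ) :
    zeroExt (vermaRho K p s lam j x) k = wCoef K lam j (k + j) * zeroExt x (k + j) := by
  by_cases hk : k < p
  · have h1 : ¬ ((j : ℤ) = -1) := by omega
    have h2 : (0 : ℤ) ≤ j ∧ (j : ℤ) ≤ (p : ℤ) - 2 := by omega
    rw [zeroExt, dif_pos hk]
    simp only [vermaRho, vermaMat, if_neg h1, if_pos h2, Matrix.toLin'_apply, Matrix.mulVec,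
      dotProduct, Matrix.of_apply, Int.toNat_natCast, ite_mul, zero_mul]
    by_cases hkj : k + j < p
    · rw [Finset.sum_eq_single ⟨k + j, hkj⟩]
      · simp [zeroExt, hkj]
      · intro l _ hl
        rw [if_neg]
        exact fun h => hl (Fin.ext h)
      · simp
    · rw [zeroExt_of_le x (by omega), mul_zero]
      refine Finset.sum_eq_zero fun l _ => ?_
      rw [if_neg (by omega)]
  · rw [zeroExt_of_le _ (by omega), zeroExt_of_le x (by omega), mul_zero]

theorem zeroExt_vermaRho_pow (s lam : K) {j : ℕ} (hj : j + 2 ≤ p) (x : Fin p → K) (m k : ℕ) :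
    zeroExt ((vermaRho K p s lam j ^ m) x) k =
      (∏ t ∈ Finset.range m, wCoef K lam j (k + (t + 1) * j)) * zeroExt x (k + m * j) := by
  induction m generalizing x with
  | zero => simp
  | succ m ih =>
    rw [pow_succ, Module.End.mul_apply, ih, zeroExt_vermaRho s lam hj, Finset.prod_range_succ]
    rw [show k + m * j + j = k + (m + 1) * j by ring]
    ring

theorem oneDimRho_natCast (lam : K) (j : ℕ) :
    oneDimRho K lam j = oneDimWeight lam j • (1 : Module.End K K) := by
  unfold oneDimRho oneDimWeight
  by_cases h : j = 0 <;> simp [h]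

/-- Coordinates of a linear map `K → K^p`. -/
def coord (c : ℤ → K →ₗ[K] (Fin p → K)) (i k : ℕ) : K := zeroExt (c i 1) k

theorem linearMap_eq_iff_zeroExt {f g : K →ₗ[K] (Fin p → K)} :
    f = g ↔ ∀ n < p, zeroExt (f 1) n = zeroExt (g 1) n := by
  rw [← zeroExt_inj]
  exact ⟨fun h => by rw [h], fun h => LinearMap.ext_ring h⟩

theorem mem_ker_bracketConstraint_iff (s lam : K) {i j : ℕ} (hi : i + 2 ≤ p) (hj : j + 2 ≤ p)
    (c : ℤ → K →ₗ[K] (Fin p → K)) :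
    c ∈ LinearMap.ker (bracketConstraint K p 0 (vermaRho K p s lam) (oneDimRho K lam) i j) ↔
      ∀ k < p, ((j : K) - i) * coord c (i + j) k =
        wCoef K lam i (k + i) * coord c j (k + i) + oneDimWeight lam j * coord c i k
        - wCoef K lam j (k + j) * coord c i (k + j) - oneDimWeight lam i * coord c j k := by
  have h : (0 : ℤ) ≤ i ∧ (i : ℤ) ≤ (p : ℤ) - 2 ∧ (0 : ℤ) ≤ j ∧ (j : ℤ) ≤ (p : ℤ) - 2 := by omega
  rw [LinearMap.mem_ker, bracketConstraint, if_pos h, linearMap_eq_iff_zeroExt]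
  refine forall_congr' fun k => forall_congr' fun hk => ?_
  simp only [oneDimRho_natCast, LinearMap.add_apply, LinearMap.sub_apply, LinearMap.smul_apply,
    LinearMap.comp_apply, LinearMap.proj_apply, LinearMap.llcomp_apply, LinearMap.lcomp_apply,
    Module.End.one_apply, map_smul, LinearMap.zero_apply,
    zeroExt_add, zeroExt_sub, zeroExt_smul, zeroExt_zero, zeroExt_vermaRho s lam hi,
    zeroExt_vermaRho s lam hj, coord, Nat.cast_add, Int.cast_sub, Int.cast_natCast]
  constructor <;> intro h <;> linear_combination h

theorem mem_ker_pcharConstraint_iff (s lam : K) {i : ℕ} (hi : i + 2 ≤ p)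
    (c : ℤ → K →ₗ[K] (Fin p → K)) :
    c ∈ LinearMap.ker (pcharConstraint K p 0 (vermaRho K p s lam) (oneDimRho K lam) i) ↔
      ∀ k < p, ∑ m ∈ Finset.range p, oneDimWeight lam i ^ (p - 1 - m) *
        ((∏ t ∈ Finset.range m, wCoef K lam i (k + (t + 1) * i)) * coord c i (k + m * i)) =
        if i = 0 then coord c 0 k else 0 := by
  have h : (0 : ℤ) ≤ i ∧ (i : ℤ) ≤ (p : ℤ) - 2 := by omega
  rw [LinearMap.mem_ker, pcharConstraint, if_pos h, LinearMap.sub_apply, sub_eq_zero,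
    linearMap_eq_iff_zeroExt]
  refine forall_congr' fun k => forall_congr' fun hk => ?_
  have hr : zeroExt (((if (i : ℤ) = 0 then (LinearMap.proj 0 : (ℤ → K →ₗ[K] (Fin p → K)) →ₗ[K] _)
      else 0) c) 1) k = if i = 0 then coord c 0 k else 0 := by
    by_cases h0 : i = 0 <;> simp [h0, coord, zeroExt_zero]
  rw [hr]
  simp only [oneDimRho_natCast, smul_pow, one_pow, LinearMap.sum_apply, LinearMap.smul_apply,
    LinearMap.comp_apply, LinearMap.proj_apply, LinearMap.llcomp_apply, LinearMap.lcomp_apply,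
    Module.End.one_apply, map_smul, zeroExt_sum, zeroExt_smul, zeroExt_vermaRho_pow s lam hi,
    coord]

theorem mem_cocycles_iff (s lam : K) (c : ℤ → K →ₗ[K] (Fin p → K)) :
    c ∈ cocycles K p 0 (vermaRho K p s lam) (oneDimRho K lam) ↔
      (∀ k : ℤ, (k < 0 ∨ (p : ℤ) - 2 < k) → c k = 0) ∧
      (∀ i j k : ℕ, i + 2 ≤ p → j + 2 ≤ p → k < p →
        ((j : K) - i) * coord c (i + j) k =
        wCoef K lam i (k + i) * coord c j (k + i) + oneDimWeight lam j * coord c i k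
        - wCoef K lam j (k + j) * coord c i (k + j) - oneDimWeight lam i * coord c j k) ∧
      (∀ i k : ℕ, i + 2 ≤ p → k < p →
        ∑ m ∈ Finset.range p, oneDimWeight lam i ^ (p - 1 - m) *
        ((∏ t ∈ Finset.range m, wCoef K lam i (k + (t + 1) * i)) * coord c i (k + m * i)) =
        if i = 0 then coord c 0 k else 0) := by
  unfold cocycles
  simp only [Submodule.mem_inf, Submodule.mem_iInf, and_assoc]
  refine and_congr ?_ (and_congr ?_ ?_)
  · refine forall_congr' fun k => ?_
    unfold suppConstraint
    split <;> simp_all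
  · constructor
    · intro h i j k hi hj hk
      exact (mem_ker_bracketConstraint_iff s lam hi hj c).1 (h i j) k hk
    · intro h i j
      by_cases hij : (0 : ℤ) ≤ i ∧ i ≤ (p : ℤ) - 2 ∧ (0 : ℤ) ≤ j ∧ j ≤ (p : ℤ) - 2
      · lift i to ℕ using hij.1
        lift j to ℕ using hij.2.2.1
        have hi : i + 2 ≤ p := by omega
        have hj : j + 2 ≤ p := by omega
        exact (mem_ker_bracketConstraint_iff s lam hi hj c).2 fun k hk => h i j k hi hj hk
      · rw [LinearMap.mem_ker, bracketConstraint, if_neg hij, LinearMap.zero_apply]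
  · constructor
    · intro h i k hi hk
      exact (mem_ker_pcharConstraint_iff s lam hi c).1 (h i) k hk
    · intro h i
      by_cases hij : (0 : ℤ) ≤ i ∧ i ≤ (p : ℤ) - 2
      · lift i to ℕ using hij.1
        have hi : i + 2 ≤ p := by omega
        exact (mem_ker_pcharConstraint_iff s lam hi c).2 fun k hk => h i k hi hk
      · rw [LinearMap.mem_ker, pcharConstraint, if_neg hij, LinearMap.zero_apply]

theorem mem_coboundaries_iff (s lam : K) (c : ℤ → K →ₗ[K] (Fin p → K)) :
    c ∈ coboundaries K p 0 (vermaRho K p s lam) (oneDimRho K lam) ↔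
      (∀ k : ℤ, (k < 0 ∨ (p : ℤ) - 2 < k) → c k = 0) ∧
      ∃ f : Fin p → K, ∀ j k : ℕ, j + 2 ≤ p → k < p →
        coord c j k = wCoef K lam j (k + j) * zeroExt f (k + j)
          - oneDimWeight lam j * zeroExt f k := by
  have key : ∀ (f : K →ₗ[K] (Fin p → K)) (j k : ℕ), j + 2 ≤ p →
      zeroExt ((LinearMap.llcomp K K (Fin p → K) (Fin p → K) (vermaRho K p s lam j)
        - LinearMap.lcomp K (Fin p → K) (oneDimRho K lam j) :
          (K →ₗ[K] (Fin p → K)) →ₗ[K] (K →ₗ[K] (Fin p → K))) f 1) k =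
      wCoef K lam j (k + j) * zeroExt (f 1) (k + j) - oneDimWeight lam j * zeroExt (f 1) k := by
    intro f j k hj
    simp only [oneDimRho_natCast, LinearMap.sub_apply, LinearMap.smul_apply,
      LinearMap.llcomp_apply, LinearMap.lcomp_apply,
      Module.End.one_apply, map_smul, zeroExt_sub, zeroExt_smul, zeroExt_vermaRho s lam hj]
  unfold coboundaries
  rw [LinearMap.mem_range]
  constructor
  · rintro ⟨f, rfl⟩
    refine ⟨fun k hk => ?_, f 1, fun j k hj hk => ?_⟩
    · rw [LinearMap.pi_apply, if_neg (by omega), LinearMap.zero_apply]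
    · rw [coord, LinearMap.pi_apply, if_pos (by omega)]
      exact key f j k hj
  · rintro ⟨h0, f, hf⟩
    refine ⟨LinearMap.toSpanSingleton K _ f, funext fun j => ?_⟩
    rw [LinearMap.pi_apply]
    by_cases hj : 0 ≤ j ∧ j ≤ (p : ℤ) - 2
    · rw [if_pos hj]
      lift j to ℕ using hj.1
      rw [linearMap_eq_iff_zeroExt]
      intro k hk
      rw [key _ j k (by omega)]
      simpa [coord] using (hf j k (by omega) hk).symm
    · rw [if_neg hj, LinearMap.zero_apply, h0 j (by omega)]

end Coordinates

section Recurrence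

variable {K : Type} [Field K] {p : ℕ}

theorem natCast_ne_zero_of_lt_char [CharP K p] {n : ℕ} (h0 : 0 < n) (h : n < p) :
    (n : K) ≠ 0 := fun hn =>
  absurd (Nat.le_of_dvd h0 ((CharP.cast_eq_zero_iff K p n).1 hn)) (by omega)

theorem factorial_ne_zero_of_lt_char [CharP K p] {n : ℕ} (h : n < p) :
    (n.factorial : K) ≠ 0 := by
  induction n with
  | zero => simp
  | succ n ih =>
    rw [Nat.factorial_succ, Nat.cast_mul]
    exact mul_ne_zero (natCast_ne_zero_of_lt_char (by omega) h) (ih (by omega))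

theorem neg_one_pow_mul_descFactorial [CharP K p] {m j i : ℕ} (hm : m + (j + 1) = p)
    (hi : i ≤ m) :
    (-1 : K) ^ i * (m.descFactorial i : K) * (j.factorial : K) = ((i + j).factorial : K) := by
  induction i with
  | zero => simp
  | succ i ih =>
    have hp : (m : K) + (j + 1) = 0 := by
      have := CharP.cast_eq_zero K p
      rw [← hm] at this
      exact_mod_cast this
    rw [Nat.descFactorial_succ, Nat.cast_mul, Nat.cast_sub (by omega),
      show i + 1 + j = (i + j) + 1 by ring, Nat.factorial_succ, Nat.cast_mul, ← ih (by omega)]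
    push_cast
    linear_combination -(-1 : K) ^ i * (m.descFactorial i : K) * (j.factorial : K) * hp

theorem factorial_mul_wCoef [CharP K p] (lam : K) {m j i : ℕ} (hm : m + (j + 1) = p)
    (hi : i ≤ m) :
    (j.factorial : K) * wCoef K lam i m =
      ((i + j).factorial : K) * (((i : K) + 1) * lam + i + (j + 1)) := by
  have hp : (m : K) + (j + 1) = 0 := by
    have := CharP.cast_eq_zero K p
    rw [← hm] at this
    exact_mod_cast this
  rw [← neg_one_pow_mul_descFactorial hm hi, wCoef]
  linear_combination -(-1 : K) ^ i * (m.descFactorial i : K) * (j.factorial : K) * hp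

/-- The bracket relations satisfied by the normalized resonant coordinates of a cocycle. -/
def ResonantRel (p : ℕ) (lam : K) (b : ℕ → K) : Prop :=
  ∀ i j : ℕ, 1 ≤ i → 1 ≤ j → i + j ≤ p →
    ((j : K) - i) * b (i + j) =
      (((i : K) + 1) * lam + i + j) * b j - (((j : K) + 1) * lam + i + j) * b i

theorem ResonantRel.eq_of_eq [CharP K p] {lam : K} {b b' : ℕ → K}
    (hb : ResonantRel p lam b) (hb' : ResonantRel p lam b') (h1 : b 1 = b' 1) (h2 : b 2 = b' 2) :
    ∀ n, 1 ≤ n → n ≤ p → b n = b' n := by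
  intro n hn
  induction n, hn using Nat.le_induction with
  | base => exact fun _ => h1
  | succ n hn ih =>
    intro hnp
    obtain rfl | hn2 := hn.eq_or_lt
    · exact h2
    have e := hb 1 n le_rfl hn (by omega)
    have e' := hb' 1 n le_rfl hn (by omega)
    rw [ih (by omega), h1, ← e', Nat.add_comm 1 n] at e
    refine mul_left_cancel₀ ?_ e
    have := natCast_ne_zero_of_lt_char (K := K) (p := p) (n := n - 1) (by omega) (by omega)
    rwa [Nat.cast_sub hn] at this

theorem resonantRel_linear (lam : K) (t : K) :
    ResonantRel p lam fun n => t * (((n : K) + 1) * lam + n) := by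
  intro i j _ _ _
  push_cast
  ring

theorem resonantRel_zero (s t : K) :
    ResonantRel p (0 : K) fun n => s * n + t * (n : K) ^ 2 := by
  intro i j _ _ _
  push_cast
  ring

theorem resonantRel_neg_one (s t : K) :
    ResonantRel p (-1 : K) fun n => if n = 1 then s else t := by
  intro i j hi hj _
  have hij : i + j ≠ 1 := by omega
  simp only [if_neg hij]
  obtain rfl | h1 := eq_or_ne i 1 <;> obtain rfl | h2 := eq_or_ne j 1
  · simp
  · simp only [if_neg h2, if_true]; push_cast; ring
  · simp only [if_neg h1, if_true]; push_cast; ring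
  · simp only [if_neg h1, if_neg h2]; ring

theorem ResonantRel.eq_zero [CharP K p] (hp : 5 ≤ p) {lam : K} (h0 : lam ≠ 0)
    (h1 : lam ≠ -1) {b : ℕ → K} (hb : ResonantRel p lam b) (hbp : b (p - 1) = 0) :
    ∀ n, 1 ≤ n → n ≤ p → b n = 0 := by
  have two : (2 : K) ≠ 0 := by
    exact_mod_cast natCast_ne_zero_of_lt_char (K := K) (p := p) (n := 2) (by omega) (by omega)
  have r12 := hb 1 2 (by omega) (by omega) (by omega)
  have r13 := hb 1 3 (by omega) (by omega) (by omega)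
  have r14 := hb 1 4 (by omega) (by omega) (by omega)
  have r23 := hb 2 3 (by omega) (by omega) (by omega)
  norm_num at r12 r13 r14 r23
  have key : (2 * lam + 1) * b 2 = (3 * lam + 2) * b 1 := by
    have hne : 4 * lam * (lam + 1) ≠ 0 := by
      refine mul_ne_zero (mul_ne_zero ?_ h0) fun h => h1 (eq_neg_of_add_eq_zero_left h)
      rw [show (4 : K) = 2 * 2 by norm_num]
      exact mul_ne_zero two two
    refine mul_left_cancel₀ hne ?_
    linear_combination 6 * r23 - 2 * r14 - (2 * lam + 5) * r13 + 2 * (5 - 2 * lam ^ 2) * r12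
  have hlin : ∀ n, 1 ≤ n → n ≤ p →
      b n = (2 * b 2 - 3 * b 1) * (((n : K) + 1) * lam + n) := by
    refine hb.eq_of_eq (resonantRel_linear lam _) ?_ ?_
    · push_cast
      linear_combination (-2) * key
    · push_cast
      linear_combination (-3) * key
  have ht : 2 * b 2 - 3 * b 1 = 0 := by
    have h := hlin (p - 1) (by omega) (by omega)
    rw [hbp, Nat.cast_sub (by omega), CharP.cast_eq_zero] at h
    push_cast at h
    linear_combination h
  intro n hn hnp
  rw [hlin n hn hnp, ht, zero_mul]

open scoped Classical in
/-- The resonant coordinates of the exceptional cocycle for `λ = 0` or `λ = -1`. -/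
noncomputable def resonantSol (lam : K) (n : ℕ) : K :=
  if lam = 0 then (n : K) + (n : K) ^ 2 else if n = 1 then 1 else 0

theorem resonantSol_zero : resonantSol (0 : K) = fun n : ℕ => (n : K) + (n : K) ^ 2 := by
  ext n; simp [resonantSol]

theorem resonantSol_neg_one : resonantSol (-1 : K) = fun n : ℕ => if n = 1 then 1 else 0 := by
  ext n; simp [resonantSol]

theorem resonantRel_resonantSol {lam : K} (h : lam = 0 ∨ lam = -1) :
    ResonantRel p lam (resonantSol lam) := by
  obtain rfl | rfl := h
  · rw [resonantSol_zero]
    simpa using resonantRel_zero (p := p) (1 : K) 1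
  · rw [resonantSol_neg_one]
    exact resonantRel_neg_one (p := p) (1 : K) 0

theorem resonantSol_pred_char [CharP K p] (hp : 5 ≤ p) {lam : K} (h : lam = 0 ∨ lam = -1) :
    resonantSol lam (p - 1) = 0 := by
  obtain rfl | rfl := h
  · rw [resonantSol_zero]
    simp [Nat.cast_sub (show 1 ≤ p by omega)]
  · rw [resonantSol_neg_one]
    simp; omega

theorem resonantSol_char [CharP K p] (hp : 5 ≤ p) {lam : K} (h : lam = 0 ∨ lam = -1) :
    resonantSol lam p = 0 := by
  obtain rfl | rfl := h
  · rw [resonantSol_zero]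
    simp
  · rw [resonantSol_neg_one]
    simp; omega

theorem resonantSol_one_ne_zero [CharP K p] (hp : 5 ≤ p) {lam : K} (h : lam = 0 ∨ lam = -1) :
    resonantSol lam 1 ≠ 0 := by
  obtain rfl | rfl := h
  · rw [resonantSol_zero]
    have two := natCast_ne_zero_of_lt_char (K := K) (p := p) (n := 2) (by omega) (by omega)
    norm_num at two ⊢
    exact two
  · rw [resonantSol_neg_one]
    simp

theorem ResonantRel.exists_eq_mul_resonantSol [CharP K p] (hp : 5 ≤ p) {lam : K}
    (h : lam = 0 ∨ lam = -1) {b : ℕ → K} (hb : ResonantRel p lam b) (hbp : b (p - 1) = 0) :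
    ∃ t : K, ∀ n, 1 ≤ n → n ≤ p → b n = t * resonantSol lam n := by
  obtain rfl | rfl := h
  · have two : (2 : K) ≠ 0 := by
      exact_mod_cast natCast_ne_zero_of_lt_char (K := K) (p := p) (n := 2) (by omega) (by omega)
    obtain ⟨t, ht⟩ : ∃ t : K, 2 * t = b 2 - 2 * b 1 := ⟨(b 2 - 2 * b 1) / 2, by field_simp⟩
    have hq := hb.eq_of_eq (resonantRel_zero (p := p) (b 1 - t) t)
      (by push_cast; ring) (by push_cast; linear_combination -ht)
    have h := hq (p - 1) (by omega) (by omega)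
    rw [hbp, Nat.cast_sub (by omega), CharP.cast_eq_zero] at h
    push_cast at h
    refine ⟨t, fun n hn hnp => ?_⟩
    rw [hq n hn hnp, resonantSol_zero]
    linear_combination (n : K) * h
  · have hq := hb.eq_of_eq (resonantRel_neg_one (p := p) (b 1) (b 2)) (by simp) (by simp)
    have h := hq (p - 1) (by omega) (by omega)
    rw [hbp, if_neg (by omega)] at h
    refine ⟨b 1, fun n hn hnp => ?_⟩
    rw [hq n hn hnp, resonantSol_neg_one, ← h]
    simp

end Recurrence

section ExtComputation

variable {K : Type} [Field K] {p : ℕ}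

theorem wCoef_zero_left (lam : K) (i : ℕ) : wCoef K lam 0 i = lam - i := by
  simp [wCoef]

/-- The coordinates `coord c j (p - j)` of a cocycle `c`, which a coboundary cannot change,
divided by `(j - 1)!`. -/
def resonantCoord (p : ℕ) (c : ℤ → K →ₗ[K] (Fin p → K)) (j : ℕ) : K :=
  coord c j (p - j) / ((j - 1).factorial : K)

theorem resonantCoord_eq_zero_of_lt {s lam : K} {c : ℤ → K →ₗ[K] (Fin p → K)}
    (hc : c ∈ cocycles K p 0 (vermaRho K p s lam) (oneDimRho K lam)) {j : ℕ} (hj : p < j + 2) :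
    resonantCoord p c j = 0 := by
  rw [resonantCoord, coord, ((mem_cocycles_iff s lam c).1 hc).1 j (by omega)]
  simp [zeroExt_zero]

theorem resonantRel_resonantCoord [CharP K p] {s lam : K} {c : ℤ → K →ₗ[K] (Fin p → K)}
    (hc : c ∈ cocycles K p 0 (vermaRho K p s lam) (oneDimRho K lam)) :
    ResonantRel p lam (resonantCoord p c) := by
  intro i j hi hj hij
  by_cases hij' : i + 2 ≤ p ∧ j + 2 ≤ p
  · have h := ((mem_cocycles_iff s lam c).1 hc).2.1 i j (p - (i + j)) hij'.1 hij'.2 (by omega)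
    obtain ⟨a, rfl⟩ : ∃ a, i = a + 1 := ⟨i - 1, by omega⟩
    obtain ⟨b, rfl⟩ : ∃ b, j = b + 1 := ⟨j - 1, by omega⟩
    rw [show p - (a + 1 + (b + 1)) + (a + 1) = p - (b + 1) by omega,
      show p - (a + 1 + (b + 1)) + (b + 1) = p - (a + 1) by omega,
      oneDimWeight, oneDimWeight, if_neg (by omega), if_neg (by omega)] at h
    have w1 := factorial_mul_wCoef (p := p) lam (m := p - (b + 1)) (j := b) (i := a + 1)
      (by omega) (by omega)
    have w2 := factorial_mul_wCoef (p := p) lam (m := p - (a + 1)) (j := a) (i := b + 1)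
      (by omega) (by omega)
    rw [show b + 1 + a = a + 1 + b by ring] at w2
    have e : ∀ m, m < p →
        coord c (m + 1) (p - (m + 1)) = (m.factorial : K) * resonantCoord p c (m + 1) :=
      fun m hm => (mul_div_cancel₀ _ (factorial_ne_zero_of_lt_char (p := p) hm)).symm
    have fn := factorial_ne_zero_of_lt_char (K := K) (p := p) (n := a + 1 + b) (by omega)
    rw [e a (by omega), e b (by omega), show a + 1 + (b + 1) = a + 1 + b + 1 by ring,
      e (a + 1 + b) (by omega)] at h
    refine mul_left_cancel₀ fn ?_
    rw [show a + 1 + (b + 1) = a + 1 + b + 1 by ring]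
    push_cast at *
    linear_combination h + resonantCoord p c (b + 1) * w1 - resonantCoord p c (a + 1) * w2
  · have hp0 := CharP.cast_eq_zero K p
    have e : ∀ j, p < j + 2 → resonantCoord p c j = 0 :=
      fun j hj => resonantCoord_eq_zero_of_lt hc hj
    have hsum : (i : K) + j = 0 := by
      rw [← Nat.cast_add, show i + j = p by omega, hp0]
    rw [e (i + j) (by omega)]
    obtain ⟨rfl, hjp⟩ | ⟨rfl, hip⟩ : (i = 1 ∧ p < j + 2) ∨ (j = 1 ∧ p < i + 2) := by omega
    · rw [e j hjp]
      push_cast at *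
      linear_combination (lam + 1) * resonantCoord p c 1 * hsum
    · rw [e i hip]
      push_cast at *
      linear_combination -(lam + 1) * resonantCoord p c 1 * hsum

theorem mem_coboundaries_of_resonantCoord_eq_zero [CharP K p] {s lam : K}
    {c : ℤ → K →ₗ[K] (Fin p → K)}
    (hp : 5 ≤ p)
    (hc : c ∈ cocycles K p 0 (vermaRho K p s lam) (oneDimRho K lam))
    (h0 : ∀ j, 1 ≤ j → j ≤ p → resonantCoord p c j = 0) :
    c ∈ coboundaries K p 0 (vermaRho K p s lam) (oneDimRho K lam) := by
  have hp0 := CharP.cast_eq_zero K p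
  obtain ⟨hs, hb, hch⟩ := (mem_cocycles_iff s lam c).1 hc
  refine (mem_coboundaries_iff s lam c).2
    ⟨hs, fun k => -coord c 0 k / ((k : ℕ) : K), fun j k hj hk => ?_⟩
  have hf : ∀ n : ℕ, (n : K) * zeroExt (fun k : Fin p => -coord c 0 k / ((k : ℕ) : K)) n =
      -coord c 0 n := by
    intro n
    by_cases hn : n < p
    · obtain rfl | hn0 := Nat.eq_zero_or_pos n
      · have h := hch 0 0 (by omega) (by omega)
        rw [if_pos rfl, Finset.sum_congr rfl (g := fun _ => lam ^ (p - 1) * coord c 0 0)] at h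
        · simp at h
          simp [← h]
        · intro m hm
          rw [Finset.mem_range] at hm
          simp only [mul_zero, add_zero, wCoef_zero_left, Nat.cast_zero, sub_zero,
            Finset.prod_const, Finset.card_range, oneDimWeight, if_true]
          rw [← mul_assoc, ← pow_add, Nat.sub_add_cancel (by omega)]
      · rw [zeroExt, dif_pos hn]
        exact mul_div_cancel₀ _ (natCast_ne_zero_of_lt_char hn0 hn)
    · rw [zeroExt_of_le _ (by omega), coord, zeroExt_of_le _ (by omega), mul_zero, neg_zero]
  obtain rfl | hj0 := Nat.eq_zero_or_pos j
  · have := hf k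
    simp only [wCoef_zero_left, oneDimWeight, if_true, Nat.add_zero]
    linear_combination this
  · rw [oneDimWeight, if_neg (by omega), zero_mul, sub_zero]
    by_cases hkj : k + j = p
    · rw [zeroExt_of_le _ hkj.ge, mul_zero]
      have h := h0 j hj0 (by omega)
      rw [resonantCoord, div_eq_zero_iff, show p - j = k by omega] at h
      exact h.resolve_right (factorial_ne_zero_of_lt_char (p := p) (by omega))
    · have h := hb 0 j k (by omega) hj hk
      have hne : ((k + j : ℕ) : K) ≠ 0 := by
        intro h
        obtain ⟨d, hd⟩ := (CharP.cast_eq_zero_iff K p _).1 h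
        have : d = 1 := by nlinarith
        subst this
        omega
      have hf' := hf (k + j)
      refine mul_left_cancel₀ hne ?_
      simp only [wCoef_zero_left, oneDimWeight, if_true, if_neg hj0.ne', Nat.cast_zero, zero_add,
        Nat.add_zero] at h
      push_cast at *
      linear_combination h - wCoef K lam j (k + j) * hf'

/-- The family `e_j ↦ (j - 1)! β_j v_{p-j}` for `1 ≤ j ≤ p - 2`, and `e_j ↦ 0` otherwise. -/
def resonantCocycle (p : ℕ) (β : ℕ → K) (j : ℤ) : K →ₗ[K] (Fin p → K) :=
  LinearMap.toSpanSingleton K _ fun k =>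
    if 1 ≤ j ∧ j ≤ (p : ℤ) - 2 ∧ (k : ℤ) + j = p then
      ((j.toNat - 1).factorial : K) * β j.toNat else 0

theorem coord_resonantCocycle {β : ℕ → K} (h1 : β (p - 1) = 0) (h2 : β p = 0) (j k : ℕ) :
    coord (resonantCocycle p β) j k =
      if 1 ≤ j ∧ k + j = p then ((j - 1).factorial : K) * β j else 0 := by
  simp only [coord, resonantCocycle, LinearMap.toSpanSingleton_apply, one_smul, zeroExt,
    Int.toNat_natCast]
  by_cases h : 1 ≤ j ∧ k + j = p
  · rw [if_pos h, dif_pos (by omega)]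
    by_cases hj : j + 2 ≤ p
    · rw [if_pos (by omega)]
    · rw [if_neg (by omega)]
      obtain rfl | rfl : j = p - 1 ∨ j = p := by omega
      · rw [h1, mul_zero]
      · rw [h2, mul_zero]
  · rw [if_neg h]
    split
    · rw [if_neg (by omega)]
    · rfl

theorem resonantCoord_resonantCocycle [CharP K p] {β : ℕ → K} (h1 : β (p - 1) = 0)
    (h2 : β p = 0) {j : ℕ} (hj : 1 ≤ j) (hjp : j ≤ p) :
    resonantCoord p (resonantCocycle p β) j = β j := by
  rw [resonantCoord, coord_resonantCocycle h1 h2, if_pos (by omega)]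
  exact mul_div_cancel_left₀ _ (factorial_ne_zero_of_lt_char (p := p) (by omega))

theorem resonantCocycle_mem_cocycles [CharP K p] (hp : 5 ≤ p) {s lam : K} {β : ℕ → K}
    (h1 : β (p - 1) = 0) (h2 : β p = 0) (hβ : ResonantRel p lam β)
    (hprod : ∃ n, 1 ≤ n ∧ n < p ∧ wCoef K lam 1 n = 0) :
    resonantCocycle p β ∈ cocycles K p 0 (vermaRho K p s lam) (oneDimRho K lam) := by
  have hp0 := CharP.cast_eq_zero K p
  have hz0 : ∀ k, coord (resonantCocycle p β) 0 k = 0 := fun k => by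
    simpa using coord_resonantCocycle h1 h2 0 k
  have hres : ∀ j k : ℕ, 1 ≤ j → ((k : K) + j) * coord (resonantCocycle p β) j k = 0 := by
    intro j k hj
    rw [coord_resonantCocycle h1 h2]
    split_ifs with h
    · rw [← Nat.cast_add, h.2, hp0, zero_mul]
    · rw [mul_zero]
  refine (mem_cocycles_iff s lam _).2 ⟨fun k hk => ?_, fun i j k hi hj hk => ?_,
    fun i k hi hk => ?_⟩
  · ext m
    simp only [resonantCocycle, LinearMap.toSpanSingleton_apply, LinearMap.zero_apply,
      Pi.zero_apply, one_smul]
    rw [if_neg (by omega)]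
  · obtain rfl | hi0 := Nat.eq_zero_or_pos i
    · obtain rfl | hj0 := Nat.eq_zero_or_pos j
      · simp [hz0]
      · have := hres j k hj0
        simp only [Nat.cast_zero, zero_add, hz0, wCoef_zero_left, oneDimWeight, if_true,
          Nat.add_zero]
        linear_combination this
    · obtain rfl | hj0 := Nat.eq_zero_or_pos j
      · have := hres i k hi0
        simp only [Nat.cast_zero, add_zero, hz0, wCoef_zero_left, oneDimWeight, if_true]
        linear_combination -this
      · simp only [oneDimWeight, if_neg hi0.ne', if_neg hj0.ne']
        rw [coord_resonantCocycle h1 h2 (i + j), coord_resonantCocycle h1 h2 i (k + j),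
          coord_resonantCocycle h1 h2 j (k + i)]
        by_cases hkij : k + (i + j) = p
        · rw [if_pos (by omega), if_pos (by omega), if_pos (by omega)]
          have h := hβ i j hi0 hj0 (by omega)
          obtain ⟨a, rfl⟩ : ∃ a, i = a + 1 := ⟨i - 1, by omega⟩
          obtain ⟨b, rfl⟩ : ∃ b, j = b + 1 := ⟨j - 1, by omega⟩
          have w1 := factorial_mul_wCoef (p := p) lam (m := k + (a + 1)) (j := b) (i := a + 1)
            (by omega) (by omega)
          have w2 := factorial_mul_wCoef (p := p) lam (m := k + (b + 1)) (j := a) (i := b + 1)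
            (by omega) (by omega)
          rw [show b + 1 + a = a + 1 + b by ring] at w2
          rw [show a + 1 + (b + 1) - 1 = a + 1 + b by omega, Nat.add_sub_cancel,
            Nat.add_sub_cancel]
          push_cast at *
          linear_combination ((a + 1 + b).factorial : K) * h - β (b + 1) * w1 + β (a + 1) * w2
        · rw [if_neg (by omega), if_neg (by omega), if_neg (by omega)]
          ring
  · obtain rfl | hi0 := Nat.eq_zero_or_pos i
    · simp only [hz0]
      simp
    · rw [if_neg hi0.ne']
      refine Finset.sum_eq_zero fun m hm => ?_
      rw [Finset.mem_range] at hm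
      by_cases hm1 : m = p - 1
      · subst hm1
        rw [coord_resonantCocycle h1 h2]
        split_ifs with h
        · have hmul : k + p * i = p := by
            obtain ⟨q, rfl⟩ : ∃ q, p = q + 1 := ⟨p - 1, by omega⟩
            simp only [Nat.add_sub_cancel] at h
            linarith [h.2]
          have hi1 : i = 1 := by nlinarith
          subst hi1
          have hk0 : k = 0 := by omega
          subst hk0
          obtain ⟨n, hn1, hnp, hn⟩ := hprod
          rw [Finset.prod_eq_zero (i := n - 1) (by rw [Finset.mem_range]; omega), zero_mul,
            mul_zero]
          rw [show 0 + (n - 1 + 1) * 1 = n by omega, hn]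
        · simp
      · rw [oneDimWeight, if_neg hi0.ne', zero_pow (by omega), zero_mul]

theorem resonantCocycle_notMem_coboundaries (hp : 5 ≤ p) {s lam : K} {β : ℕ → K}
    (h1 : β (p - 1) = 0) (h2 : β p = 0) (hβ : β 1 ≠ 0) :
    resonantCocycle p β ∉ coboundaries K p 0 (vermaRho K p s lam) (oneDimRho K lam) := by
  intro h
  obtain ⟨-, f, hf⟩ := (mem_coboundaries_iff s lam _).1 h
  have h := hf 1 (p - 1) (by omega) (by omega)
  rw [coord_resonantCocycle h1 h2, if_pos (by omega), zeroExt_of_le _ (by omega)] at h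
  apply hβ
  simpa [oneDimWeight] using h

theorem resonantCoord_sub_smul (c z : ℤ → K →ₗ[K] (Fin p → K)) (t : K) (j : ℕ) :
    resonantCoord p (c - t • z) j = resonantCoord p c j - t * resonantCoord p z j := by
  simp only [resonantCoord, coord, Pi.sub_apply, Pi.smul_apply, LinearMap.sub_apply,
    LinearMap.smul_apply, zeroExt_sub, zeroExt_smul]
  ring

theorem exists_wCoef_one_eq_zero [CharP K p] (hp : 5 ≤ p) {lam : K} (h : lam = 0 ∨ lam = -1) :
    ∃ n, 1 ≤ n ∧ n < p ∧ wCoef K lam 1 n = 0 := by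
  obtain rfl | rfl := h
  · exact ⟨1, le_rfl, by omega, by simp [wCoef]⟩
  · refine ⟨p - 1, by omega, by omega, ?_⟩
    rw [wCoef, Nat.cast_sub (by omega), CharP.cast_eq_zero K p]
    push_cast
    ring

end ExtComputation

open scoped Classical in
/-- If `χ` has height `-1`, `0` or `1` and `λ ∈ Λ(χ)`, then, over `W_0`,
`Ext(K_λ, V_χ(λ)) ≅ K` if `λ ∈ {0, p-1}` and `Ext(K_λ, V_χ(λ)) = 0` otherwise. -/
theorem ext_Klambda_verma_self
    (K : Type) [Field K] [IsAlgClosed K] (p : ℕ) [CharP K p] (hp : 3 < p)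
    (chi : ℤ → K) (hsupp : ∀ k : ℤ, (k < -1 ∨ (p : ℤ) - 2 < k) → chi k = 0)
    (hheight : ∀ k : ℤ, 1 ≤ k → chi k = 0)
    (lam : K) (hlam : lam ^ p - lam = chi 0 ^ p) :
    Module.finrank K (extSpace K p 0
        (vermaRho K p (chi (-1) ^ p) lam) (oneDimRho K lam))
      = if lam = 0 ∨ lam = (p : K) - 1 then 1 else 0 := by
  have hp5 : 5 ≤ p := by
    have h4 : p ≠ 4 := by
      rintro rfl
      exact absurd ((CharP.char_is_prime_or_zero K 4).resolve_right (by omega)) (by norm_num)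
    omega
  rw [CharP.cast_eq_zero, zero_sub]
  split_ifs with h
  · have z1 := resonantSol_pred_char hp5 h
    have z2 := resonantSol_char hp5 h
    have hz : resonantCocycle p (resonantSol lam) ∈
        cocycles K p 0 (vermaRho K p (chi (-1) ^ p) lam) (oneDimRho K lam) :=
      resonantCocycle_mem_cocycles hp5 z1 z2 (resonantRel_resonantSol h)
        (exists_wCoef_one_eq_zero hp5 h)
    refine finrank_eq_one_iff'.2 ⟨Submodule.Quotient.mk ⟨_, hz⟩, ?_, ?_⟩
    · rw [Ne, Submodule.Quotient.mk_eq_zero]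
      exact resonantCocycle_notMem_coboundaries hp5 z1 z2 (resonantSol_one_ne_zero hp5 h)
    · intro w
      obtain ⟨⟨c, hc⟩, rfl⟩ := Submodule.Quotient.mk_surjective _ w
      obtain ⟨t, ht⟩ := (resonantRel_resonantCoord hc).exists_eq_mul_resonantSol hp5 h
        (resonantCoord_eq_zero_of_lt hc (by omega))
      refine ⟨t, ?_⟩
      rw [← Submodule.Quotient.mk_smul, eq_comm, Submodule.Quotient.eq]
      refine mem_coboundaries_of_resonantCoord_eq_zero hp5
        (Submodule.sub_mem _ hc (Submodule.smul_mem _ t hz)) fun j hj hjp => ?_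
      refine (resonantCoord_sub_smul c _ t j).trans ?_
      rw [resonantCoord_resonantCocycle z1 z2 hj hjp, ht j hj hjp, sub_self]
  · rw [not_or] at h
    have : Subsingleton (extSpace K p 0
        (vermaRho K p (chi (-1) ^ p) lam) (oneDimRho K lam)) := by
      refine Submodule.Quotient.subsingleton_iff.2 (eq_top_iff.2 ?_)
      rintro ⟨c, hc⟩ -
      exact mem_coboundaries_of_resonantCoord_eq_zero hp5 hc
        ((resonantRel_resonantCoord hc).eq_zero hp5 h.1 h.2
          (resonantCoord_eq_zero_of_lt hc (by omega)))
    exact Module.finrank_zero_of_subsingleton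
end

section
/- Let χ be a linear functional on W of height exactly 1 and let λ ∈ Λ(χ). Then Ext(K_λ, V_χ(λ)) = 0 in the category of W_0-modules with p-character χ; that is, every short exact sequence 0 → V_χ(λ) → M → K_λ → 0 of W_0-modules with p-character χ splits (here V_χ(λ) is regarded as a W_0-module by restriction). -/
/-!
Common setup: the Witt algebra `W` over `K` (char `p > 3`) has basis
`e_{-1}, e_0, ..., e_{p-2}` with `[e_i, e_j] = (j-i) e_{i+j}` (and `e_k = 0`
outside the range), and `p`-mapping `e_i^{[p]} = δ_{i0} e_i`.  A module with
`p`-character `χ` over `W` (resp. the subalgebra `W_0 = <e_0, ..., e_{p-2}>`)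
is given by a family of endomorphisms `ρ k` (`k : ℤ`, vanishing outside
`[lo, p-2]` where `lo = -1` for `W` and `lo = 0` for `W_0`) satisfying the
bracket relations and `(ρ i)^p - δ_{i0} ρ i = χ(e_i)^p • 1`.

The Baer Ext space `Ext(N, M)` of two such modules, in the category of
modules with `p`-character `χ`, is realized concretely: an extension
`0 → M → E → N → 0` admits a linear splitting `E ≃ M ⊕ N`, under which the
action of `e_k` is `(m, n) ↦ (ρM k m + c k n, ρN k n)` for a "cocycle"
`c : ℤ → (N →ₗ M)`; the conditions for `E` to be a module with `p`-character
`χ` are the cocycle conditions below, Baer equivalence corresponds to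
differing by a coboundary, and the Baer sum / scalar action correspond to the
linear structure on cocycles.  So `Ext(N, M) ≅ cocycles / coboundaries`.
-/

set_option maxHeartbeats 1000000
set_option synthInstance.maxHeartbeats 1000000

theorem vermaRho_natCast_apply (K : Type) [Field K] (p : ℕ) (c lam : K) (j : ℕ) (hj : j + 2 ≤ p)
    (x : Fin p → K) (i : ℕ) (hi : i < p) :
    vermaRho K p c lam j x ⟨i, hi⟩ =
      if h : i + j < p then wCoef K lam j (i + j) * x ⟨i + j, h⟩ else 0 := by
  have hrange : (0 : ℤ) ≤ (j : ℤ) ∧ (j : ℤ) ≤ (p : ℤ) - 2 := by omega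
  have hneg : (j : ℤ) ≠ -1 := by omega
  simp only [vermaRho, vermaMat, if_neg hneg, if_pos hrange, Matrix.toLin'_apply,
    Matrix.mulVec, dotProduct, Matrix.of_apply, Int.toNat_natCast, ite_mul, zero_mul]
  split_ifs with h
  · rw [Finset.sum_eq_single ⟨i + j, h⟩]
    · simp
    · intro l _ hl
      rw [if_neg fun h' => hl (Fin.ext h')]
    · simp
  · exact Finset.sum_eq_zero fun l _ => if_neg (by omega)

theorem two_mul_sub_natCast_add_one_ne_zero {K : Type} [Field K] {p : ℕ} [CharP K p]
    [Fact p.Prime] (hp : 3 < p) {lam : K} (hlam : lam ^ p ≠ lam) (n : ℕ) :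
    2 * lam - n + 1 ≠ 0 := by
  intro h
  have hn : 2 * lam + 1 = n := by linear_combination h
  have hfrob := congrArg (frobenius K p) hn
  simp only [map_add, map_mul, map_one, map_ofNat, map_natCast, frobenius_def] at hfrob
  have htwo : ((2 : ℕ) : K) ≠ 0 := by
    rw [Ne, CharP.cast_eq_zero_iff K p]
    exact fun hd => absurd (Nat.le_of_dvd two_pos hd) (by omega)
  refine hlam (mul_left_cancel₀ htwo ?_)
  push_cast
  linear_combination hfrob - hn

theorem natCast_ne_zero_of_lt {K : Type} [Field K] {p : ℕ} [CharP K p] {n : ℕ}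
    (h0 : 0 < n) (hn : n < p) : (n : K) ≠ 0 := by
  rw [Ne, CharP.cast_eq_zero_iff K p]
  exact fun hd => absurd (Nat.le_of_dvd h0 hd) (by omega)

theorem wCoef_one_ne_zero {K : Type} [Field K] {p : ℕ} [CharP K p] [Fact p.Prime]
    (hp : 3 < p) {lam : K} (hlam : lam ^ p ≠ lam) {i : ℕ} (h0 : 0 < i) (hi : i < p) :
    wCoef K lam 1 i ≠ 0 := by
  have h := two_mul_sub_natCast_add_one_ne_zero hp hlam i
  have hi' : (i : K) ≠ 0 := natCast_ne_zero_of_lt h0 hi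
  simp only [wCoef, Nat.descFactorial_one, Nat.cast_one, one_add_one_eq_two]
  exact mul_ne_zero (mul_ne_zero (by simp) hi') h

theorem wCoef_zero (K : Type) [Field K] (lam : K) (i : ℕ) : wCoef K lam 0 i = lam - i := by
  simp [wCoef]

/-- Powers of `e_1` detect the coordinates of a vector of the Verma module. -/
theorem apply_eq_zero_of_vermaRho_one_pow {K : Type} [Field K] {p : ℕ} [CharP K p]
    [Fact p.Prime] (hp : 3 < p) {c lam : K} (hlam : lam ^ p ≠ lam) (k : ℕ) (hk : k < p)
    (x : Fin p → K) (h : (vermaRho K p c lam 1 ^ k) x ⟨0, by omega⟩ = 0) :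
    x ⟨k, hk⟩ = 0 := by
  induction k generalizing x with
  | zero => simpa using h
  | succ k ih =>
    rw [pow_succ, Module.End.mul_apply] at h
    have h1 := ih (by omega) _ h
    have h2 := vermaRho_natCast_apply K p c lam 1 (by omega) x k (by omega)
    rw [Nat.cast_one, h1, dif_pos hk] at h2
    exact (mul_eq_zero.mp h2.symm).resolve_left (wCoef_one_ne_zero hp hlam (by omega) hk)

/-- The constraints defining the cocycles, evaluated at the generator of `K_λ`. -/
theorem cocycle_oneDim_apply {K : Type} [Field K] {p : ℕ} {c lam : K} {z : ℤ → K →ₗ[K] (Fin p → K)}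
    (hz : z ∈ cocycles K p 0 (vermaRho K p c lam) (oneDimRho K lam)) :
    (∀ k : ℤ, k < 0 ∨ (p : ℤ) - 2 < k → z k = 0) ∧
    (∀ i j : ℕ, i + 2 ≤ p → j + 2 ≤ p →
      ((j : K) - i) • z ((i + j : ℕ) : ℤ) 1 - vermaRho K p c lam i (z j 1)
        - z i (oneDimRho K lam j 1) + vermaRho K p c lam j (z i 1)
        + z j (oneDimRho K lam i 1) = 0) ∧
    (∀ i : ℕ, i + 2 ≤ p →
      ∑ k ∈ Finset.range p, (vermaRho K p c lam i ^ k)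
          (z i ((oneDimRho K lam i ^ (p - 1 - k)) 1))
        = if i = 0 then z 0 1 else 0) := by
  simp only [cocycles, Submodule.mem_inf, Submodule.mem_iInf, LinearMap.mem_ker] at hz
  obtain ⟨⟨hs, hb⟩, hc⟩ := hz
  refine ⟨fun k hk => ?_, fun i j hi hj => ?_, fun i hi => ?_⟩
  · simpa [suppConstraint, hk] using hs k
  · have h := hb i j
    rw [bracketConstraint, if_pos (by omega)] at h
    simpa using LinearMap.congr_fun h 1
  · have h := hc i
    rw [pcharConstraint, if_pos (by omega)] at h
    have h1 := LinearMap.congr_fun h 1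
    by_cases h0 : i = 0
    · subst h0
      simpa [sub_eq_zero] using h1
    · simpa [h0] using h1

/-- If `χ` has height exactly `1` and `λ ∈ Λ(χ)`, then, over `W_0`,
`Ext(K_λ, V_χ(λ)) = 0`: every short exact sequence `0 → V_χ(λ) → M → K_λ → 0`
of `W_0`-modules with `p`-character `χ` splits (every cocycle is a coboundary). -/
theorem ext_Klambda_verma_self_height_one
    (K : Type) [Field K] [IsAlgClosed K] (p : ℕ) [CharP K p] (hp : 3 < p)
    (chi : ℤ → K) (hsupp : ∀ k : ℤ, (k < -1 ∨ (p : ℤ) - 2 < k) → chi k = 0)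
    (hheight : ∀ k : ℤ, 1 ≤ k → chi k = 0)
    (hht1 : chi 0 ≠ 0)
    (lam : K) (hlam : lam ^ p - lam = chi 0 ^ p) :
    cocycles K p 0 (vermaRho K p (chi (-1) ^ p) lam) (oneDimRho K lam) ≤
      coboundaries K p 0 (vermaRho K p (chi (-1) ^ p) lam) (oneDimRho K lam) := by
  have hprime : p.Prime := (CharP.char_is_prime_or_zero K p).resolve_right (by omega)
  have : Fact p.Prime := ⟨hprime⟩
  have hlam' : lam ^ p ≠ lam := fun h => by
    rw [h, sub_self] at hlam
    exact hht1 (pow_eq_zero_iff hprime.ne_zero |>.mp hlam.symm)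
  have hpK : (p : K) = 0 := CharP.cast_eq_zero K p
  generalize chi (-1) ^ p = c
  intro z hz
  obtain ⟨hs, hb, hc⟩ := cocycle_oneDim_apply hz
  have hzero : z 0 1 ⟨0, by omega⟩ = 0 := by
    have h := congrFun (hc 0 (by omega)) ⟨0, by omega⟩
    have hpow (k : ℕ) (x : Fin p → K) :
        (vermaRho K p c lam 0 ^ k) x ⟨0, by omega⟩ = lam ^ k * x ⟨0, by omega⟩ := by
      induction k generalizing x with
      | zero => simp
      | succ k ih =>
        have h2 := vermaRho_natCast_apply K p c lam 0 (by omega) x 0 (by omega)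
        rw [dif_pos (by omega), wCoef_zero] at h2
        simp only [Nat.cast_zero, add_zero, sub_zero] at h2
        rw [pow_succ, Module.End.mul_apply, ih, h2]
        ring
    have hsum (k : ℕ) (hk : k ∈ Finset.range p) :
        (vermaRho K p c lam 0 ^ k) (z 0 ((oneDimRho K lam 0 ^ (p - 1 - k)) 1)) ⟨0, by omega⟩
          = lam ^ (p - 1) * z 0 1 ⟨0, by omega⟩ := by
      have h1 : (oneDimRho K lam 0 ^ (p - 1 - k)) 1 = lam ^ (p - 1 - k) • (1 : K) := by
        simp [oneDimRho, smul_pow]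
      rw [h1, map_smul, map_smul, Pi.smul_apply, hpow, smul_eq_mul, ← mul_assoc, ← pow_add]
      congr 2
      have := Finset.mem_range.mp hk
      omega
    rw [Finset.sum_apply] at h
    simp only [Nat.cast_zero, if_true] at h
    rw [Finset.sum_congr rfl hsum] at h
    simpa [hpK] using h.symm
  have hweight (j i : ℕ) (hj : j + 2 ≤ p) (hj0 : 0 < j) (hi : i < p) :
      ((i : K) + j) * z j 1 ⟨i, hi⟩ =
        -(if h : i + j < p then wCoef K lam j (i + j) * z 0 1 ⟨i + j, h⟩ else 0) := by
    have h := congrFun (hb 0 j (by omega) hj) ⟨i, hi⟩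
    have hlam1 : oneDimRho K lam (0 : ℕ) 1 = lam • (1 : K) := by simp [oneDimRho]
    have hz1 : oneDimRho K lam j 1 = 0 := by simp [oneDimRho, hj0.ne']
    rw [hlam1, hz1, map_smul] at h
    have hd := vermaRho_natCast_apply K p c lam 0 (by omega) (z j 1) i hi
    rw [dif_pos (by omega), wCoef_zero, Nat.cast_zero] at hd
    simp only [add_zero] at hd
    simp only [map_zero, Pi.add_apply, Pi.sub_apply, Pi.smul_apply, Pi.zero_apply, hd,
      vermaRho_natCast_apply K p c lam j hj, zero_add, smul_eq_mul, Nat.cast_zero] at h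
    linear_combination h
  have hone : z 1 1 ⟨p - 1, by omega⟩ = 0 := by
    refine apply_eq_zero_of_vermaRho_one_pow (c := c) hp hlam' (p - 1) (by omega) _ ?_
    have h := congrFun (hc 1 (by omega)) ⟨0, by omega⟩
    rw [Finset.sum_eq_single_of_mem (p - 1) (Finset.mem_range.mpr (by omega))] at h
    · simpa using h
    · intro k hk hne
      have hk' := Finset.mem_range.mp hk
      have : p - 1 - k ≠ 0 := by omega
      simp [oneDimRho, this]
  have hdown (n : ℕ) : ∀ j : ℕ, 2 ≤ j → j + n + 1 = p →
      ∀ h : p - j < p, z j 1 ⟨p - j, h⟩ = 0 := by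
    induction n with
    | zero =>
      intro j hj hjn h
      rw [hs j (by omega)]
      rfl
    | succ n ih =>
      intro j hj hjn h
      have hb1 := congrFun (hb 1 j (by omega) (by omega)) ⟨p - (j + 1), by omega⟩
      have hj0 : j ≠ 0 := by omega
      have ih' := ih (1 + j) (by omega) (by omega) (by omega)
      have e1 : p - (j + 1) + 1 = p - j := by omega
      have e2 : p - (j + 1) + j = p - 1 := by omega
      have e3 : p - (1 + j) = p - (j + 1) := by omega
      have hz1 : oneDimRho K lam j 1 = 0 := by simp [oneDimRho, hj0]
      have hz2 : oneDimRho K lam (1 : ℕ) 1 = 0 := by simp [oneDimRho]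
      simp only [e3] at ih'
      rw [hz1, hz2] at hb1
      simp only [map_zero, Pi.add_apply, Pi.sub_apply, Pi.smul_apply, Pi.zero_apply, ih',
        vermaRho_natCast_apply K p c lam 1 (by omega),
        vermaRho_natCast_apply K p c lam j (by omega), e1, e2, h,
        dite_true, show p - 1 < p by omega] at hb1
      simp only [Nat.cast_one, hone] at hb1
      simpa [wCoef_one_ne_zero hp hlam' (show 0 < p - j by omega) h] using hb1
  let f : Fin p → K := fun i => -(z 0 1 i) / (i : ℕ)
  have hf (m : ℕ) (hm : m < p) : (m : K) * f ⟨m, hm⟩ = -z 0 1 ⟨m, hm⟩ := by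
    rcases Nat.eq_zero_or_pos m with rfl | h0
    · rw [hzero]
      simp
    · have := natCast_ne_zero_of_lt (K := K) h0 hm
      simp only [f]
      field_simp
  refine ⟨LinearMap.toSpanSingleton K (Fin p → K) f, funext fun k => ?_⟩
  rw [LinearMap.pi_apply]
  split_ifs with hk
  swap
  · rw [hs k (by omega)]
    rfl
  obtain ⟨j, rfl⟩ := Int.eq_ofNat_of_zero_le hk.1
  have hj : j + 2 ≤ p := by omega
  refine LinearMap.ext_ring (funext fun ⟨i, hi⟩ => ?_)
  simp only [LinearMap.sub_apply, LinearMap.llcomp_apply, LinearMap.lcomp_apply,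
    LinearMap.toSpanSingleton_apply, one_smul, Pi.sub_apply, Pi.smul_apply,
    vermaRho_natCast_apply K p c lam j hj]
  rcases Nat.eq_zero_or_pos j with rfl | hj0
  · simp only [add_zero, hi, dite_true, wCoef_zero, oneDimRho, Nat.cast_zero, if_true,
      LinearMap.smul_apply, Module.End.one_apply, smul_eq_mul, mul_one]
    linear_combination -hf i hi
  · have hz1 : oneDimRho K lam j 1 = 0 := by simp [oneDimRho, hj0.ne']
    rw [hz1, zero_smul, sub_zero]
    have hw := hweight j i hj hj0 hi
    have hne (hij : i + j ≠ p) : (i : K) + j ≠ 0 := by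
      rw [← Nat.cast_add, Ne, CharP.cast_eq_zero_iff K p]
      rintro ⟨q, hq⟩
      have hq2 : q < 2 := by
        by_contra hcon
        have := Nat.mul_le_mul_left p (show 2 ≤ q by omega)
        omega
      interval_cases q <;> omega
    split_ifs with h
    · rw [dif_pos h] at hw
      have hfij := hf (i + j) h
      push_cast at hfij
      refine mul_left_cancel₀ (hne (by omega)) ?_
      linear_combination wCoef K lam j (i + j) * hfij - hw
    · rw [dif_neg h, neg_zero] at hw
      by_cases hij : i + j = p
      · obtain rfl : i = p - j := by omega
        rcases eq_or_ne j 1 with rfl | hj1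
        · exact hone.symm
        · exact (hdown (p - j - 1) j (by omega) (by omega) hi).symm
      · exact ((mul_eq_zero.mp hw).resolve_left (hne hij)).symm
end
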